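/- Let f be a complex ternary quartic form which defines a smooth complex plane curve, i.e., for every nonzero point (x,y,z) ∈ ℂ³ with f(x,y,z) = 0, at least one partial derivative of f is nonzero at (x,y,z). Then f has exactly 63 equivalence classes of quadratic representations f = p² + q² + r² with complex quadratic forms p, q, r, where two representations are equivalent if the triples of quadratic forms have the same linear span. -/

import Mathlib

/-- The type of quadratic representations of a complex ternary quartic `f`, i.e.
expressions `f = p² + q² + r²` with `p, q, r` complex quadratic forms. -/
def QuadRep (f : MvPolynomial (Fin 3) ℂ) : Type :=
  { t : MvPolynomial (Fin 3) ℂ × MvPolynomial (Fin 3) ℂ × MvPolynomial (Fin 3) ℂ //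
      t.1.IsHomogeneous 2 ∧ t.2.1.IsHomogeneous 2 ∧ t.2.2.IsHomogeneous 2 ∧
      f = t.1 ^ 2 + t.2.1 ^ 2 + t.2.2 ^ 2 }

/-- Two quadratic representations are equivalent when the triples of quadratic
forms have the same linear span in the space of quadratic forms. -/
noncomputable def QuadRepSetoid (f : MvPolynomial (Fin 3) ℂ) : Setoid (QuadRep f) :=
  Setoid.ker (fun t =>
    Submodule.span ℂ ({t.1.1, t.1.2.1, t.1.2.2} : Set (MvPolynomial (Fin 3) ℂ)))

section

open MvPolynomial Matrix

/-- The linear form `∑ i, l i * X i`. -/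
noncomputable def linForm (l : Fin 3 → ℂ) : MvPolynomial (Fin 3) ℂ := ∑ i, C (l i) * X i

/-- The linear substitution `x ↦ A x`. -/
noncomputable def linSubst (A : Matrix (Fin 3) (Fin 3) ℂ) :
    MvPolynomial (Fin 3) ℂ →ₐ[ℂ] MvPolynomial (Fin 3) ℂ :=
  aeval fun i => linForm (A i)

/-- A ternary form defines a smooth plane curve. -/
def IsSmoothForm (f : MvPolynomial (Fin 3) ℂ) : Prop :=
  ∀ x : Fin 3 → ℂ, x ≠ 0 → eval x f = 0 → ∃ i : Fin 3, eval x (pderiv i f) ≠ 0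

@[simp] lemma eval_linForm (l x : Fin 3 → ℂ) : eval x (linForm l) = l ⬝ᵥ x := by
  simp [linForm, dotProduct]

lemma isHomogeneous_linForm (l : Fin 3 → ℂ) : (linForm l).IsHomogeneous 1 :=
  IsHomogeneous.sum _ _ _ fun _ _ => isHomogeneous_C_mul_X _ _

lemma linForm_smul (k : ℂ) (l : Fin 3 → ℂ) : linForm (k • l) = C k * linForm l := by
  simp [linForm, Finset.mul_sum, mul_assoc]

lemma linForm_ne_zero {l : Fin 3 → ℂ} (hl : l ≠ 0) : linForm l ≠ 0 := by
  intro h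
  apply hl
  ext i
  have := congrArg (eval (Pi.single i 1)) h
  simpa using this

@[simp] lemma eval_linSubst (A : Matrix (Fin 3) (Fin 3) ℂ) (p : MvPolynomial (Fin 3) ℂ)
    (x : Fin 3 → ℂ) : eval x (linSubst A p) = eval (A *ᵥ x) p := by
  have h : (aeval (R := ℂ) x).comp (linSubst A) = aeval (A *ᵥ x) := by
    ext i
    simp only [AlgHom.comp_apply, linSubst, aeval_X]
    exact eval_linForm _ _
  exact DFunLike.congr_fun h p

lemma isHomogeneous_linSubst (A : Matrix (Fin 3) (Fin 3) ℂ) {p : MvPolynomial (Fin 3) ℂ} {n : ℕ}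
    (hp : p.IsHomogeneous n) : (linSubst A p).IsHomogeneous n := by
  simpa [linSubst] using hp.aeval (fun i => linForm (A i)) fun i => isHomogeneous_linForm (A i)

lemma eval_smul_of_isHomogeneous {p : MvPolynomial (Fin 3) ℂ} {n : ℕ} (hp : p.IsHomogeneous n)
    (k : ℂ) (x : Fin 3 → ℂ) : eval (k • x) p = k ^ n * eval x p := by
  rw [eval_eq', eval_eq', Finset.mul_sum]
  refine Finset.sum_congr rfl fun d hd => ?_
  have : ∑ i, d i = n := by
    have := hp (mem_support_iff.mp hd)
    simpa [Finsupp.weight_apply, Finsupp.sum_fintype] using this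
  simp only [Pi.smul_apply, smul_eq_mul, mul_pow, Finset.prod_mul_distrib, Finset.prod_pow_eq_pow_sum,
    this]
  ring

/-- A homogeneous complement of a homogeneous factor is homogeneous. -/
lemma exists_isHomogeneous_factor {p q c : MvPolynomial (Fin 3) ℂ} {m n : ℕ}
    (hq : q.IsHomogeneous m) (hp : p.IsHomogeneous (m + n)) (h : p = q * c) :
    ∃ c', c'.IsHomogeneous n ∧ p = q * c' := by
  refine ⟨homogeneousComponent n c, homogeneousComponent_isHomogeneous _ _, ?_⟩
  have h1 : homogeneousComponent (m + n) p = p := homogeneousComponent_eq_self hp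
  rw [← h1, h]
  conv_lhs => rw [← sum_homogeneousComponent c, Finset.mul_sum, map_sum]
  have key : ∀ i, homogeneousComponent (m + n) (q * homogeneousComponent i c) =
      if i = n then q * homogeneousComponent n c else 0 := by
    intro i
    rw [homogeneousComponent_of_mem (hq.mul (homogeneousComponent_isHomogeneous i c))]
    by_cases hi : i = n
    · simp [hi]
    · rw [if_neg hi, if_neg (by omega)]
  simp only [key, Finset.sum_ite_eq', Finset.mem_range]
  split_ifs with hn
  · rfl
  · rw [homogeneousComponent_eq_zero _ _ (by omega), mul_zero]

lemma linForm_dvd_sub_linSubst (l v : Fin 3 → ℂ) (p : MvPolynomial (Fin 3) ℂ) :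
    linForm l ∣ p - linSubst (1 - vecMulVec v l) p := by
  rw [← Ideal.mem_span_singleton, ← Ideal.Quotient.mk_eq_mk_iff_sub_mem]
  set I := Ideal.span {linForm l}
  have : (Ideal.Quotient.mkₐ ℂ I) = (Ideal.Quotient.mkₐ ℂ I).comp (linSubst (1 - vecMulVec v l)) := by
    ext i
    simp only [AlgHom.comp_apply, linSubst, aeval_X]
    change Ideal.Quotient.mk I _ = Ideal.Quotient.mk I _
    rw [Ideal.Quotient.mk_eq_mk_iff_sub_mem, Ideal.mem_span_singleton]
    refine ⟨C (v i), MvPolynomial.funext fun x => ?_⟩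
    simp only [map_sub, eval_X, eval_linForm, map_mul, eval_C]
    have : (1 - vecMulVec v l) i ⬝ᵥ x = x i - v i * (l ⬝ᵥ x) := by
      have : (1 - vecMulVec v l) i ⬝ᵥ x = ((1 - vecMulVec v l) *ᵥ x) i := rfl
      rw [this, sub_mulVec, vecMulVec_mulVec]
      simp [mul_comm]
    rw [this]; ring
  exact DFunLike.congr_fun this p

lemma exists_dotProduct_eq_one {l : Fin 3 → ℂ} (hl : l ≠ 0) : ∃ v : Fin 3 → ℂ, l ⬝ᵥ v = 1 := by
  obtain ⟨i, hi⟩ := Function.ne_iff.mp hl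
  exact ⟨Pi.single i (l i)⁻¹, by simpa using mul_inv_cancel₀ hi⟩

lemma linForm_dvd_iff_linSubst {l v : Fin 3 → ℂ} (hv : l ⬝ᵥ v = 1) (p : MvPolynomial (Fin 3) ℂ) :
    linForm l ∣ p ↔ linSubst (1 - vecMulVec v l) p = 0 := by
  constructor
  · rintro ⟨q, rfl⟩
    have : linSubst (1 - vecMulVec v l) (linForm l) = 0 := by
      refine MvPolynomial.funext fun x => ?_
      simp [sub_mulVec, vecMulVec_mulVec, hv, dotProduct_sub]
    rw [map_mul, this, zero_mul]
  · intro h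
    simpa [h] using linForm_dvd_sub_linSubst l v p

lemma linForm_dvd_of_eval {l : Fin 3 → ℂ} (hl : l ≠ 0) {p : MvPolynomial (Fin 3) ℂ}
    (h : ∀ x, l ⬝ᵥ x = 0 → eval x p = 0) : linForm l ∣ p := by
  obtain ⟨v, hv⟩ := exists_dotProduct_eq_one hl
  rw [linForm_dvd_iff_linSubst hv]
  refine MvPolynomial.funext fun x => ?_
  rw [eval_linSubst, map_zero]
  apply h
  simp [sub_mulVec, vecMulVec_mulVec, hv, dotProduct_sub]

lemma eval_eq_zero_of_linForm_dvd {l : Fin 3 → ℂ} {p : MvPolynomial (Fin 3) ℂ}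
    (h : linForm l ∣ p) {x : Fin 3 → ℂ} (hx : l ⬝ᵥ x = 0) : eval x p = 0 := by
  obtain ⟨q, rfl⟩ := h
  simp [hx]

lemma linForm_dvd_or_dvd {l : Fin 3 → ℂ} (hl : l ≠ 0) {p q : MvPolynomial (Fin 3) ℂ}
    (h : linForm l ∣ p * q) : linForm l ∣ p ∨ linForm l ∣ q := by
  obtain ⟨v, hv⟩ := exists_dotProduct_eq_one hl
  simpa only [linForm_dvd_iff_linSubst hv, map_mul, mul_eq_zero] using h

lemma cross_eq_zero_iff {l m : Fin 3 → ℂ} (hl : l ≠ 0) : crossProduct l m = 0 ↔ ∃ k : ℂ, m = k • l := by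
  constructor
  · intro h
    obtain ⟨v, hv⟩ := exists_dotProduct_eq_one hl
    refine ⟨m ⬝ᵥ v, ?_⟩
    have := cross_cross_eq_smul_sub_smul l m v
    rw [h, LinearMap.map_zero₂, hv, one_smul] at this
    exact (sub_eq_zero.mp this.symm)
  · rintro ⟨k, rfl⟩
    simp

lemma linForm_dvd_linForm {l m : Fin 3 → ℂ} (h : linForm l ∣ linForm m) :
    crossProduct l m = 0 := by
  ext i
  have h1 : l ⬝ᵥ crossProduct (Pi.single i 1) l = 0 := dot_cross_self _ _
  have h2 := eval_eq_zero_of_linForm_dvd h h1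
  rw [eval_linForm, triple_product_permutation] at h2
  simpa using h2

lemma linForm_mul_dvd {l m : Fin 3 → ℂ} (hl : l ≠ 0) (hlm : crossProduct l m ≠ 0)
    {p : MvPolynomial (Fin 3) ℂ} (h1 : linForm l ∣ p) (h2 : linForm m ∣ p) :
    linForm l * linForm m ∣ p := by
  obtain ⟨q, rfl⟩ := h2
  rcases linForm_dvd_or_dvd hl h1 with h | h
  · exact absurd (linForm_dvd_linForm h) hlm
  · rw [mul_comm]
    exact mul_dvd_mul_left _ h

/-- The Hessian matrix of a ternary quadratic form. -/
noncomputable def quadHess (a : MvPolynomial (Fin 3) ℂ) : Matrix (Fin 3) (Fin 3) ℂ :=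
  .of fun i j => coeff 0 (pderiv j (pderiv i a))

lemma quadHess_add (a b : MvPolynomial (Fin 3) ℂ) : quadHess (a + b) = quadHess a + quadHess b := by
  ext i j; simp [quadHess]

lemma quadHess_C_mul (k : ℂ) (a : MvPolynomial (Fin 3) ℂ) : quadHess (C k * a) = k • quadHess a := by
  ext i j; simp [quadHess]

lemma pderiv_pderiv_comm (i j : Fin 3) (a : MvPolynomial (Fin 3) ℂ) :
    pderiv i (pderiv j a) = pderiv j (pderiv i a) := by
  let D : Fin 3 → Derivation ℂ (MvPolynomial (Fin 3) ℂ) (MvPolynomial (Fin 3) ℂ) := pderiv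
  have : ⁅D i, D j⁆ = 0 := by
    refine derivation_ext fun k => ?_
    simp [D, Derivation.commutator_apply, pderiv_X, Pi.single_apply, apply_ite]
  have h := DFunLike.congr_fun this a
  rw [Derivation.commutator_apply] at h
  exact sub_eq_zero.mp h

lemma quadHess_isSymm (a : MvPolynomial (Fin 3) ℂ) : (quadHess a).IsSymm := by
  ext i j; simp [quadHess, pderiv_pderiv_comm i j]

section
variable {a : MvPolynomial (Fin 3) ℂ} (ha : a.IsHomogeneous 2)
include ha

lemma eval_pderiv_of_isHomogeneous_two (x : Fin 3 → ℂ) (i : Fin 3) :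
    eval x (pderiv i a) = (quadHess a *ᵥ x) i := by
  have h1 : (pderiv i a).IsHomogeneous 1 := ha.pderiv
  have h2 := congrArg (eval x) h1.sum_X_mul_pderiv
  simp only [one_smul] at h2
  rw [← h2, map_sum, mulVec, dotProduct]
  refine Finset.sum_congr rfl fun j _ => ?_
  have h3 : (pderiv j (pderiv i a)).IsHomogeneous 0 := h1.pderiv
  rw [← homogeneousComponent_eq_self h3, homogeneousComponent_zero]
  simp [quadHess, mul_comm]

lemma two_mul_eval_of_isHomogeneous_two (x : Fin 3 → ℂ) :
    2 * eval x a = x ⬝ᵥ quadHess a *ᵥ x := by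
  have h2 := congrArg (eval x) ha.sum_X_mul_pderiv
  simpa [eval_pderiv_of_isHomogeneous_two ha, dotProduct] using h2.symm

end

lemma exists_binary_zero (A B D : ℂ) : ∃ s t : ℂ, (s ≠ 0 ∨ t ≠ 0) ∧
    A * s ^ 2 + B * s * t + D * t ^ 2 = 0 := by
  by_cases hA : A = 0
  · exact ⟨1, 0, by simp, by simp [hA]⟩
  · obtain ⟨d, hd⟩ := IsAlgClosed.exists_pow_nat_eq (B ^ 2 - 4 * A * D) (n := 2) (by norm_num)
    refine ⟨(-B + d) / (2 * A), 1, by simp, ?_⟩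
    field_simp
    linear_combination hd

lemma exists_binary_factor (A B D : ℂ) : ∃ p q r s : ℂ, ∀ y z,
    A * y ^ 2 + B * y * z + D * z ^ 2 = (p * y + q * z) * (r * y + s * z) := by
  obtain ⟨s, t, h, h0⟩ := exists_binary_zero A B D
  rcases h with hs | ht
  · refine ⟨-t, s, (B * s + D * t) / s ^ 2, D / s, fun y z => ?_⟩
    have : A = -(B * s * t + D * t ^ 2) / s ^ 2 := by field_simp; linear_combination h0
    rw [this]; field_simp; ring
  · refine ⟨t, -s, A / t, (B * t + A * s) / t ^ 2, fun y z => ?_⟩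
    have : D = -(B * s * t + A * s ^ 2) / t ^ 2 := by field_simp; linear_combination h0
    rw [this]; field_simp; ring

lemma eval_smul_add_smul {a : MvPolynomial (Fin 3) ℂ} (ha : a.IsHomogeneous 2) (s t : ℂ)
    (x y : Fin 3 → ℂ) : eval (s • x + t • y) a =
      eval x a * s ^ 2 + (x ⬝ᵥ quadHess a *ᵥ y) * s * t + eval y a * t ^ 2 := by
  have hsymm : y ⬝ᵥ quadHess a *ᵥ x = x ⬝ᵥ quadHess a *ᵥ y := by
    rw [dotProduct_mulVec, ← mulVec_transpose, (quadHess_isSymm a).eq, dotProduct_comm]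
  have h := two_mul_eval_of_isHomogeneous_two ha
  refine mul_left_cancel₀ (two_ne_zero' ℂ) ?_
  rw [h]
  simp only [mulVec_add, mulVec_smul, dotProduct_add, add_dotProduct, smul_dotProduct,
    dotProduct_smul, smul_eq_mul, hsymm]
  linear_combination -s ^ 2 * h x - t ^ 2 * h y

lemma exists_eval_eq_zero_on_line {a : MvPolynomial (Fin 3) ℂ} (ha : a.IsHomogeneous 2)
    (l : Fin 3 → ℂ) : ∃ x ≠ 0, l ⬝ᵥ x = 0 ∧ eval x a = 0 := by
  obtain ⟨p, q, hpq, hp, hq⟩ : ∃ p q : Fin 3 → ℂ, crossProduct p q ≠ 0 ∧ l ⬝ᵥ p = 0 ∧ l ⬝ᵥ q = 0 := by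
    by_cases hl : l = 0
    · refine ⟨![1, 0, 0], ![0, 1, 0], fun h => ?_, by simp [hl], by simp [hl]⟩
      simpa [cross_apply] using congrFun h 2
    · obtain ⟨i, hi⟩ := Function.ne_iff.mp hl
      fin_cases i
      · refine ⟨![-l 1, l 0, 0], ![-l 2, 0, l 0], fun h => ?_, ?_, ?_⟩
        · exact hi (by simpa [cross_apply] using congrFun h 0)
        all_goals simp [dotProduct, Fin.sum_univ_three]; ring
      · refine ⟨![l 1, -l 0, 0], ![0, -l 2, l 1], fun h => ?_, ?_, ?_⟩
        · exact hi (by simpa [cross_apply] using congrFun h 1)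
        all_goals simp [dotProduct, Fin.sum_univ_three]; ring
      · refine ⟨![l 2, 0, -l 0], ![0, l 2, -l 1], fun h => ?_, ?_, ?_⟩
        · exact hi (by simpa [cross_apply] using congrFun h 2)
        all_goals simp [dotProduct, Fin.sum_univ_three]; ring
  obtain ⟨s, t, hst, h0⟩ := exists_binary_zero (eval p a) (p ⬝ᵥ quadHess a *ᵥ q) (eval q a)
  refine ⟨s • p + t • q, fun h => ?_, by simp [hp, hq], by rw [eval_smul_add_smul ha, h0]⟩
  rw [crossProduct_ne_zero_iff_linearIndependent, LinearIndependent.pair_iff] at hpq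
  have := hpq s t h
  tauto

lemma exists_factor_of_mulVec_eq_zero {a : MvPolynomial (Fin 3) ℂ} (ha : a.IsHomogeneous 2)
    {e : Fin 3 → ℂ} (he : e ≠ 0) (h : quadHess a *ᵥ e = 0) :
    ∃ l m, a = linForm l * linForm m := by
  have key (i j k : Fin 3) (hij : i ≠ j) (hik : i ≠ k) (hjk : j ≠ k)
      (hext : ∀ n, n = i ∨ n = j ∨ n = k) (hi : e i ≠ 0) : ∃ l m, a = linForm l * linForm m := by
    obtain ⟨p, q, r, s, hpq⟩ := exists_binary_factor (eval (Pi.single j 1) a)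
      (Pi.single j 1 ⬝ᵥ quadHess a *ᵥ Pi.single k 1) (eval (Pi.single k 1) a)
    let u : Fin 3 → ℂ := Pi.single j 1 - (e j / e i) • Pi.single i 1
    let v : Fin 3 → ℂ := Pi.single k 1 - (e k / e i) • Pi.single i 1
    refine ⟨p • u + q • v, r • u + s • v, MvPolynomial.funext fun x => ?_⟩
    have hx : x = (1 : ℂ) • ((u ⬝ᵥ x) • Pi.single j 1 + (v ⬝ᵥ x) • Pi.single k 1) + (x i / e i) • e := by
      ext n
      rcases hext n with rfl | rfl | rfl
      · simp [u, v, hij, hik, hi]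
      · simp [u, v, hjk]; ring
      · simp [u, v, hjk.symm]; ring
    have he' : eval e a = 0 := by
      have := two_mul_eval_of_isHomogeneous_two ha e
      simpa [h] using this
    conv_lhs => rw [hx, eval_smul_add_smul ha, h, eval_smul_add_smul ha, hpq]
    simp [he', add_dotProduct]
  obtain ⟨i, hi⟩ := Function.ne_iff.mp he
  fin_cases i
  · exact key 0 1 2 (by decide) (by decide) (by decide) (by decide) hi
  · exact key 1 0 2 (by decide) (by decide) (by decide) (by decide) hi
  · exact key 2 0 1 (by decide) (by decide) (by decide) (by decide) hi

/-- Two plane conics meet. -/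
lemma exists_common_zero {a b : MvPolynomial (Fin 3) ℂ} (ha : a.IsHomogeneous 2)
    (hb : b.IsHomogeneous 2) : ∃ x ≠ 0, eval x a = 0 ∧ eval x b = 0 := by
  obtain ⟨s, t, e, hst, he, h⟩ : ∃ (s t : ℂ) (e : Fin 3 → ℂ), (s ≠ 0 ∨ t ≠ 0) ∧ e ≠ 0 ∧
      quadHess (C s * a + C t * b) *ᵥ e = 0 := by
    by_cases hdet : (quadHess b).det = 0
    · obtain ⟨e, he, h⟩ := exists_mulVec_eq_zero_iff.mpr hdet
      exact ⟨0, 1, e, by simp, he, by simpa using h⟩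
    · obtain ⟨μ, hμ⟩ := Module.End.exists_eigenvalue (mulVecLin ((quadHess b)⁻¹ * quadHess a))
      obtain ⟨e, he⟩ := hμ.exists_hasEigenvector
      refine ⟨1, -μ, e, by simp, he.2, ?_⟩
      have h1 := congrArg (quadHess b *ᵥ ·) he.apply_eq_smul
      simp only [mulVecLin_apply, mulVec_mulVec, ← mul_assoc, mul_nonsing_inv _ (Ne.isUnit hdet),
        one_mul, mulVec_smul] at h1
      rw [quadHess_add, quadHess_C_mul, quadHess_C_mul, add_mulVec, smul_mulVec, smul_mulVec, h1]
      simp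
  have hab : (C s * a + C t * b).IsHomogeneous 2 := (ha.C_mul s).add (hb.C_mul t)
  obtain ⟨l, m, hlm⟩ := exists_factor_of_mulVec_eq_zero hab he h
  have hl (x : Fin 3 → ℂ) (hx : l ⬝ᵥ x = 0) : s * eval x a + t * eval x b = 0 := by
    have := congrArg (eval x) hlm
    simpa [hx] using this
  rcases hst with hs | ht
  · obtain ⟨x, hx, hlx, hbx⟩ := exists_eval_eq_zero_on_line hb l
    exact ⟨x, hx, by simpa [hbx, hs] using hl x hlx, hbx⟩
  · obtain ⟨x, hx, hlx, hax⟩ := exists_eval_eq_zero_on_line ha l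
    exact ⟨x, hx, hax, by simpa [hax, ht] using hl x hlx⟩

section
variable {f a b c : MvPolynomial (Fin 3) ℂ} (hf : IsSmoothForm f) (habc : f = a * c - b ^ 2)
include hf habc

lemma IsSmoothForm.eval_ne_zero_of_vertex {x : Fin 3 → ℂ} (hx : x ≠ 0) (ha : eval x a = 0)
    (hda : ∀ i, eval x (pderiv i a) = 0) : eval x b ≠ 0 := by
  intro hb
  obtain ⟨i, hi⟩ := hf x hx (by simp [habc, ha, hb])
  apply hi
  simp [habc, ha, hb, hda, Derivation.leibniz_pow]

lemma IsSmoothForm.no_common_zero {x : Fin 3 → ℂ} (hx : x ≠ 0) (ha : eval x a = 0)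
    (hb : eval x b = 0) (hc : eval x c = 0) : False := by
  obtain ⟨i, hi⟩ := hf x hx (by simp [habc, ha, hb])
  apply hi
  simp [habc, ha, hb, hc, Derivation.leibniz_pow]

variable (ha : a.IsHomogeneous 2) (hb : b.IsHomogeneous 2) (hc : c.IsHomogeneous 2)
include ha hb hc

lemma IsSmoothForm.exists_eval_eq (y z : ℂ) : ∃ x, eval x a ≠ 0 ∧ eval x b = y * eval x a ∧
    eval x c = z * eval x a := by
  obtain ⟨x, hx, h1, h2⟩ := exists_common_zero (hb.sub (ha.C_mul y)) (hc.sub (ha.C_mul z))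
  simp only [map_sub, map_mul, eval_C, sub_eq_zero] at h1 h2
  exact ⟨x, fun h => hf.no_common_zero habc hx h (by simpa [h] using h1) (by simpa [h] using h2),
    h1, h2⟩

/-- The three conics of a representation satisfy no quadratic relation. -/
lemma IsSmoothForm.no_quadratic_relation {α β γ δ ε ζ : ℂ}
    (h : C α * a ^ 2 + C β * b ^ 2 + C γ * c ^ 2 + C δ * (a * b) + C ε * (b * c) + C ζ * (a * c) = 0) :
    α = 0 ∧ β = 0 ∧ γ = 0 ∧ δ = 0 ∧ ε = 0 ∧ ζ = 0 := by
  have key (y z : ℂ) : α + β * y ^ 2 + γ * z ^ 2 + δ * y + ε * (y * z) + ζ * z = 0 := by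
    obtain ⟨x, hx, hy, hz⟩ := hf.exists_eval_eq habc ha hb hc y z
    have := congrArg (eval x) h
    simp only [map_add, map_mul, eval_C, map_pow, hy, hz, map_zero] at this
    refine (mul_eq_zero.mp ?_).resolve_left (pow_ne_zero 2 hx)
    linear_combination this
  have h0 := key 0 0
  have h1 := key 1 0
  have h2 := key (-1) 0
  have h3 := key 0 1
  have h4 := key 0 (-1)
  have h5 := key 1 1
  refine ⟨?_, ?_, ?_, ?_, ?_, ?_⟩
  · linear_combination h0
  · linear_combination h1 / 2 + h2 / 2 - h0
  · linear_combination h3 / 2 + h4 / 2 - h0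
  · linear_combination h1 / 2 - h2 / 2
  · linear_combination h5 - h1 - h3 + h0
  · linear_combination h3 / 2 - h4 / 2

lemma IsSmoothForm.no_linear_relation {α β γ : ℂ} (h : C α * a + C β * b + C γ * c = 0) :
    α = 0 ∧ β = 0 ∧ γ = 0 := by
  have h2 : C (α ^ 2) * a ^ 2 + C (β ^ 2) * b ^ 2 + C (γ ^ 2) * c ^ 2 + C (2 * α * β) * (a * b) +
      C (2 * β * γ) * (b * c) + C (2 * α * γ) * (a * c) = 0 := by
    simp only [map_mul, map_pow, map_ofNat]
    linear_combination (C α * a + C β * b + C γ * c) * h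
  obtain ⟨h1, h2, h3, -⟩ := hf.no_quadratic_relation habc ha hb hc h2
  exact ⟨pow_eq_zero_iff two_ne_zero |>.mp h1, pow_eq_zero_iff two_ne_zero |>.mp h2,
    pow_eq_zero_iff two_ne_zero |>.mp h3⟩

end

/-- The line `l = 0` is a bitangent (possibly a hyperflex tangent) of `f = 0`: the restriction of
`f` to it is a square. -/
def IsBitangent (f : MvPolynomial (Fin 3) ℂ) (l : Fin 3 → ℂ) : Prop :=
  ∃ b : MvPolynomial (Fin 3) ℂ, b.IsHomogeneous 2 ∧ ∀ x, l ⬝ᵥ x = 0 → eval x f = eval x b ^ 2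

/-- A representation of `f` as the discriminant `a * c - b ^ 2`. -/
structure IsConicRep (f a b c : MvPolynomial (Fin 3) ℂ) : Prop where
  left : a.IsHomogeneous 2
  mid : b.IsHomogeneous 2
  right : c.IsHomogeneous 2
  eq : f = a * c - b ^ 2

lemma exists_smul_of_dotProduct_eq_zero {l m : Fin 3 → ℂ} (hlm : crossProduct l m ≠ 0)
    {x : Fin 3 → ℂ} (hl : l ⬝ᵥ x = 0) (hm : m ⬝ᵥ x = 0) : ∃ k : ℂ, x = k • crossProduct l m := by
  rw [← cross_eq_zero_iff hlm, cross_cross_eq_smul_sub_smul, hl, hm, zero_smul, zero_smul, sub_zero]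

lemma exists_conicRep_of_isBitangent {f : MvPolynomial (Fin 3) ℂ} (hf : f.IsHomogeneous 4)
    {l m : Fin 3 → ℂ} (hlm : crossProduct l m ≠ 0) (hl : IsBitangent f l) (hm : IsBitangent f m) :
    ∃ b c, IsConicRep f (linForm l * linForm m) b c := by
  have hl0 : l ≠ 0 := by rintro rfl; simp at hlm
  have hm0 : m ≠ 0 := by rintro rfl; simp at hlm
  obtain ⟨b₁, hb₁, h₁⟩ := hl
  obtain ⟨b₂, hb₂, h₂, h₁₂⟩ : ∃ b₂ : MvPolynomial (Fin 3) ℂ, b₂.IsHomogeneous 2 ∧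
      (∀ x, m ⬝ᵥ x = 0 → eval x f = eval x b₂ ^ 2) ∧
      eval (crossProduct l m) b₁ = eval (crossProduct l m) b₂ := by
    obtain ⟨b₂, hb₂, h₂⟩ := hm
    have h := (h₁ _ (dot_self_cross l m)).symm.trans (h₂ _ (dot_cross_self l m))
    rcases sq_eq_sq_iff_eq_or_eq_neg.mp h with h | h
    · exact ⟨b₂, hb₂, h₂, h⟩
    · exact ⟨-b₂, hb₂.neg, by simpa using h₂, by simpa using h⟩
  obtain ⟨w, hw⟩ := exists_dotProduct_eq_one hlm
  rw [dotProduct_comm] at hw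
  set u : Fin 3 → ℂ := crossProduct w l with hu
  set v : Fin 3 → ℂ := crossProduct m w with hv
  have hlu : l ⬝ᵥ u = 0 := dot_cross_self w l
  have hmv : m ⬝ᵥ v = 0 := dot_self_cross m w
  have hmu : m ⬝ᵥ u = 1 := by rw [hu, triple_product_permutation, hw]
  have hlv : l ⬝ᵥ v = 1 := by rw [hv, ← triple_product_permutation, hw]
  have hline (x : Fin 3 → ℂ) (hx : l ⬝ᵥ x = 0) (hx' : m ⬝ᵥ x = 0) : eval x b₁ = eval x b₂ := by
    obtain ⟨k, rfl⟩ := exists_smul_of_dotProduct_eq_zero hlm hx hx'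
    rw [eval_smul_of_isHomogeneous hb₁, eval_smul_of_isHomogeneous hb₂, h₁₂]
  set b := linSubst (1 - vecMulVec v l) b₁ + linSubst (1 - vecMulVec u m) b₂ -
    linSubst (1 - vecMulVec v l - vecMulVec u m) b₁ with hb
  have hbh : b.IsHomogeneous 2 := ((isHomogeneous_linSubst _ hb₁).add
    (isHomogeneous_linSubst _ hb₂)).sub (isHomogeneous_linSubst _ hb₁)
  have hbl (x : Fin 3 → ℂ) (hx : l ⬝ᵥ x = 0) : eval x b = eval x b₁ := by
    have := hline (x - (m ⬝ᵥ x) • u) (by simp [dotProduct_sub, hx, hlu])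
      (by simp [dotProduct_sub, hmu])
    simp [hb, sub_mulVec, vecMulVec_mulVec, hx, this]
  have hbm (x : Fin 3 → ℂ) (hx : m ⬝ᵥ x = 0) : eval x b = eval x b₂ := by
    simp [hb, sub_mulVec, vecMulVec_mulVec, hx]
  obtain ⟨c, hc⟩ : linForm l * linForm m ∣ f - b ^ 2 := by
    refine linForm_mul_dvd hl0 hlm (linForm_dvd_of_eval hl0 fun x hx => ?_)
      (linForm_dvd_of_eval hm0 fun x hx => ?_)
    · simp [h₁ x hx, hbl x hx]
    · simp [h₂ x hx, hbm x hx]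
  have hlmh := (isHomogeneous_linForm l).mul (isHomogeneous_linForm m)
  obtain ⟨c', hc', h⟩ := exists_isHomogeneous_factor (n := 2) hlmh (hf.sub (hbh.pow 2)) hc
  refine ⟨C Complex.I * b, c', hlmh, hbh.C_mul _, hc', ?_⟩
  have hI : (C Complex.I : MvPolynomial (Fin 3) ℂ) ^ 2 = -1 := by
    rw [← map_pow, Complex.I_sq, map_neg, map_one]
  linear_combination h + b ^ 2 * hI

lemma isBitangent_of_dvd {f a b c : MvPolynomial (Fin 3) ℂ} (h : IsConicRep f a b c)
    {l : Fin 3 → ℂ} (hl : linForm l ∣ a) : IsBitangent f l := by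
  refine ⟨C Complex.I * b, h.mid.C_mul _, fun x hx => ?_⟩
  simp [h.eq, eval_eq_zero_of_linForm_dvd hl hx, mul_pow]

lemma eval_pderiv_linForm_mul {l m x : Fin 3 → ℂ} (hl : l ⬝ᵥ x = 0) (hm : m ⬝ᵥ x = 0) (i : Fin 3) :
    eval x (pderiv i (linForm l * linForm m)) = 0 := by
  simp [hl, hm]

lemma IsSmoothForm.cross_ne_zero {f b c : MvPolynomial (Fin 3) ℂ} (hf : IsSmoothForm f)
    {l m : Fin 3 → ℂ} (h : IsConicRep f (linForm l * linForm m) b c) : crossProduct l m ≠ 0 := by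
  intro hlm
  obtain ⟨x, hx, hlx, hbx⟩ := exists_eval_eq_zero_on_line h.mid (if l = 0 then m else l)
  have h1 : l ⬝ᵥ x = 0 ∧ m ⬝ᵥ x = 0 := by
    by_cases hl : l = 0
    · simpa [hl] using hlx
    · obtain ⟨k, rfl⟩ := (cross_eq_zero_iff hl).mp hlm
      simp_all
  exact hf.eval_ne_zero_of_vertex h.eq hx (by simp [h1.1]) (eval_pderiv_linForm_mul h1.1 h1.2) hbx

lemma isHomogeneous_zero_factor {p q c : MvPolynomial (Fin 3) ℂ} (hp : p.IsHomogeneous 2)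
    (hq : q.IsHomogeneous 2) (h : p = q * c) : ∃ k : ℂ, p = C k * q := by
  obtain ⟨c', hc', h'⟩ := exists_isHomogeneous_factor (n := 0) hq hp h
  exact ⟨coeff 0 c', by
    rw [h', mul_comm, ← homogeneousComponent_zero, homogeneousComponent_eq_self hc']⟩

lemma span_triple_le {a b c : MvPolynomial (Fin 3) ℂ} {V : Submodule ℂ (MvPolynomial (Fin 3) ℂ)}
    (ha : a ∈ V) (hb : b ∈ V) (hc : c ∈ V) : Submodule.span ℂ {a, b, c} ≤ V := by
  rw [Submodule.span_le]
  rintro x (rfl | rfl | rfl) <;> assumption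

lemma mem_span_triple_iff {a b c x : MvPolynomial (Fin 3) ℂ} :
    x ∈ Submodule.span ℂ {a, b, c} ↔ ∃ α β γ : ℂ, x = C α * a + C β * b + C γ * c := by
  simp only [Submodule.mem_span_insert, Submodule.mem_span_singleton, ← smul_eq_C_mul]
  constructor
  · rintro ⟨α, _, ⟨β, _, ⟨γ, rfl⟩, rfl⟩, rfl⟩
    exact ⟨α, β, γ, by abel⟩
  · rintro ⟨α, β, γ, rfl⟩
    exact ⟨α, _, ⟨β, _, ⟨γ, rfl⟩, rfl⟩, by abel⟩

/-- The span of a conic representation is determined by a single product of two lines in it. -/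
lemma IsSmoothForm.span_eq_span {f b c b' c' : MvPolynomial (Fin 3) ℂ} (hf : IsSmoothForm f)
    {l m : Fin 3 → ℂ} (h : IsConicRep f (linForm l * linForm m) b c)
    (h' : IsConicRep f (linForm l * linForm m) b' c') :
    Submodule.span ℂ {linForm l * linForm m, b', c'} ≤ Submodule.span ℂ {linForm l * linForm m, b, c} := by
  have hlm := hf.cross_ne_zero h
  have hl0 : l ≠ 0 := by rintro rfl; simp at hlm
  have hm0 : m ≠ 0 := by rintro rfl; simp at hlm
  have hlm0 := mul_ne_zero (linForm_ne_zero hl0) (linForm_ne_zero hm0)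
  have hfac : linForm l * linForm m * (c' - c) = (b' - b) * (b' + b) := by
    linear_combination h.eq - h'.eq
  have hPb : eval (crossProduct l m) b ≠ 0 := hf.eval_ne_zero_of_vertex h.eq hlm (by simp)
    (eval_pderiv_linForm_mul (by simp) (by simp))
  have hmix {p q : MvPolynomial (Fin 3) ℂ} (hp : linForm l ∣ p) (hq : linForm m ∣ q)
      (h : p - q = C 2 * b ∨ q - p = C 2 * b) : False := by
    have h1 : eval (crossProduct l m) p = 0 := eval_eq_zero_of_linForm_dvd hp (by simp)
    have h2 : eval (crossProduct l m) q = 0 := eval_eq_zero_of_linForm_dvd hq (by simp)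
    refine hPb ?_
    rcases h with h | h <;> simpa [h1, h2] using congrArg (eval (crossProduct l m)) h.symm
  have fin (ε : ℂ) (hε : ε ^ 2 = 1) (hd : linForm l * linForm m ∣ b' - C ε * b) :
      Submodule.span ℂ {linForm l * linForm m, b', c'} ≤ Submodule.span ℂ {linForm l * linForm m, b, c} := by
    obtain ⟨q, hq⟩ := hd
    obtain ⟨k, hk⟩ := isHomogeneous_zero_factor (h'.mid.sub (h.mid.C_mul ε)) h.left hq
    have hε' : (C ε : MvPolynomial (Fin 3) ℂ) ^ 2 = 1 := by rw [← map_pow, hε, map_one]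
    have hc : c' = c + C (2 * k * ε) * b + C (k ^ 2) * (linForm l * linForm m) := by
      refine mul_left_cancel₀ hlm0 ?_
      simp only [map_mul, map_pow, map_ofNat]
      linear_combination hfac + (b' + C ε * b + C k * (linForm l * linForm m)) * hk + b ^ 2 * hε'
    refine span_triple_le ?_ ?_ ?_ <;> rw [mem_span_triple_iff]
    · exact ⟨1, 0, 0, by simp⟩
    · exact ⟨k, ε, 0, by simp; linear_combination hk⟩
    · exact ⟨k ^ 2, 2 * k * ε, 1, by rw [hc, map_one]; ring⟩
  have hl := linForm_dvd_or_dvd hl0 (Dvd.intro _ ((mul_assoc _ _ _).symm.trans hfac))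
  have hm := linForm_dvd_or_dvd hm0 (Dvd.intro (linForm l * (c' - c)) (by rw [← hfac]; ring))
  rcases hl with hl | hl <;> rcases hm with hm | hm
  · exact fin 1 (by norm_num) (by rw [map_one, one_mul]; exact linForm_mul_dvd hl0 hlm hl hm)
  · exact (hmix hl hm (.inr (by rw [map_ofNat]; ring))).elim
  · exact (hmix hl hm (.inl (by rw [map_ofNat]; ring))).elim
  · exact fin (-1) (by norm_num) (by
      rw [map_neg, map_one, neg_one_mul, sub_neg_eq_add]; exact linForm_mul_dvd hl0 hlm hl hm)

lemma exists_mulVec_eq_zero_of_adjugate_eq_zero {H : Matrix (Fin 3) (Fin 3) ℂ}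
    (hH : H.adjugate = 0) : ∃ r : Fin 3 → ℂ, ∀ x, r ⬝ᵥ x = 0 → H *ᵥ x = 0 := by
  by_cases h0 : H = 0
  · exact ⟨0, by simp [h0]⟩
  obtain ⟨i, hi⟩ := Function.ne_iff.mp h0
  refine ⟨H i, fun x hx => funext fun k => ?_⟩
  have hc : crossProduct (H i) (H k) = 0 := by
    rw [adjugate_fin_three, ← Matrix.ext_iff] at hH
    simp only [Fin.forall_fin_succ] at hH
    simp at hH
    rw [cross_apply]
    ext j
    fin_cases i <;> fin_cases k <;> fin_cases j <;> simp <;> grind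
  obtain ⟨t, ht⟩ := (cross_eq_zero_iff hi).mp hc
  rw [mulVec, ht, smul_dotProduct, hx, smul_zero]; rfl

lemma col_adjugate_dotProduct {H : Matrix (Fin 3) (Fin 3) ℂ} (hs : H.IsSymm) (hdet : H.det = 0)
    (B : Matrix (Fin 3) (Fin 3) ℂ) (j : Fin 3) :
    H.adjugate.col j ⬝ᵥ B *ᵥ H.adjugate.col j = H.adjugate j j * (H.adjugate * B).trace := by
  have h01 := hs.apply 0 1
  have h02 := hs.apply 0 2
  have h12 := hs.apply 1 2
  rw [det_fin_three, h01, h02, h12] at hdet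
  simp only [trace, diag_apply, mul_apply, Fin.sum_univ_three]
  rw [adjugate_fin_three]
  fin_cases j <;> simp [Fin.sum_univ_three, mulVec, dotProduct, h01, h02, h12]
  · linear_combination -(B 1 1 * H 2 2 + B 2 2 * H 1 1 - B 1 2 * H 1 2 - B 2 1 * H 1 2) * hdet
  · linear_combination -(B 0 0 * H 2 2 + B 2 2 * H 0 0 - B 0 2 * H 0 2 - B 2 0 * H 0 2) * hdet
  · linear_combination -(B 0 0 * H 1 1 + B 1 1 * H 0 0 - B 0 1 * H 0 1 - B 1 0 * H 0 1) * hdet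

lemma IsSmoothForm.trace_adjugate_ne_zero {f a b c : MvPolynomial (Fin 3) ℂ} (hf : IsSmoothForm f)
    (h : IsConicRep f a b c) (hdet : (quadHess a).det = 0) :
    ((quadHess a).adjugate * quadHess b).trace ≠ 0 := by
  have hvert {x : Fin 3 → ℂ} (hx : x ≠ 0) (hx' : quadHess a *ᵥ x = 0) : eval x b ≠ 0 := by
    refine hf.eval_ne_zero_of_vertex h.eq hx ?_ fun i => ?_
    · simpa [hx'] using two_mul_eval_of_isHomogeneous_two h.left x
    · rw [eval_pderiv_of_isHomogeneous_two h.left, hx', Pi.zero_apply]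
  have hadj : (quadHess a).adjugate ≠ 0 := by
    intro h0
    obtain ⟨r, hr⟩ := exists_mulVec_eq_zero_of_adjugate_eq_zero h0
    obtain ⟨x, hx, hrx, hbx⟩ := exists_eval_eq_zero_on_line h.mid r
    exact hvert hx (hr x hrx) hbx
  obtain ⟨j, hj⟩ : ∃ j, (quadHess a).adjugate.col j ≠ 0 := by
    by_contra! h0
    exact hadj (Matrix.ext fun i j => congrFun (h0 j) i)
  intro h0
  refine hvert hj ?_ ?_
  · ext i
    change (quadHess a * (quadHess a).adjugate) i j = 0
    simp [mul_adjugate, hdet]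
  · simpa [col_adjugate_dotProduct (quadHess_isSymm a) hdet, h0] using
      two_mul_eval_of_isHomogeneous_two h.mid ((quadHess a).adjugate.col j)

lemma exists_det_polynomial (A B D : Matrix (Fin 3) (Fin 3) ℂ) : ∃ p : Polynomial ℂ,
    p.natDegree ≤ 6 ∧ p.coeff 6 = D.det ∧ (∀ s, p.eval s = (A + (2 * s) • B + s ^ 2 • D).det) ∧
    ∀ s, p.derivative.eval s =
      2 * ((A + (2 * s) • B + s ^ 2 • D).adjugate * (B + s • D)).trace := by
  let e (i j : Fin 3) : Polynomial ℂ := Polynomial.C (A i j) + Polynomial.C (2 * B i j) * Polynomial.X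
    + Polynomial.C (D i j) * Polynomial.X ^ 2
  refine ⟨(Matrix.of e).det, ?_, ?_, fun s => ?_, fun s => ?_⟩
  · simp only [det_fin_three, of_apply, e]
    compute_degree
  · simp only [det_fin_three, of_apply, e]
    compute_degree!
  · simp [det_fin_three, e]
    ring
  · simp only [trace, diag_apply, mul_apply, Fin.sum_univ_three]
    rw [adjugate_fin_three]
    simp [det_fin_three, e]
    ring

/-- The rotation of a conic representation which replaces `a` by `a + 2 s b + s² c`. -/
lemma IsConicRep.shift {f a b c : MvPolynomial (Fin 3) ℂ} (h : IsConicRep f a b c) (s : ℂ) :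
    IsConicRep f (a + C (2 * s) * b + C (s ^ 2) * c) (b + C s * c) c where
  left := (h.left.add (h.mid.C_mul _)).add (h.right.C_mul _)
  mid := h.mid.add (h.right.C_mul _)
  right := h.right
  eq := by simp only [map_mul, map_pow, map_ofNat]; linear_combination h.eq

lemma IsConicRep.symm {f a b c : MvPolynomial (Fin 3) ℂ} (h : IsConicRep f a b c) :
    IsConicRep f c b a := ⟨h.right, h.mid, h.left, by rw [h.eq]; ring⟩

lemma IsConicRep.scale {f a b c : MvPolynomial (Fin 3) ℂ} (h : IsConicRep f a b c) {k : ℂ}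
    (hk : k ≠ 0) : IsConicRep f (C k * a) b (C k⁻¹ * c) where
  left := h.left.C_mul _
  mid := h.mid
  right := h.right.C_mul _
  eq := by
    have : (C k * C k⁻¹ : MvPolynomial (Fin 3) ℂ) = 1 := by
      rw [← map_mul, mul_inv_cancel₀ hk, map_one]
    linear_combination h.eq - a * c * this

lemma span_triple_shift (a b c : MvPolynomial (Fin 3) ℂ) (s : ℂ) :
    Submodule.span ℂ {a + C (2 * s) * b + C (s ^ 2) * c, b + C s * c, c} =
      Submodule.span ℂ {a, b, c} := by
  refine le_antisymm (span_triple_le ?_ ?_ ?_) (span_triple_le ?_ ?_ ?_) <;>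
    rw [mem_span_triple_iff]
  · exact ⟨1, 2 * s, s ^ 2, by simp⟩
  · exact ⟨0, 1, s, by simp⟩
  · exact ⟨0, 0, 1, by simp⟩
  · exact ⟨1, -2 * s, s ^ 2, by simp only [map_one, map_neg, map_mul, map_pow, map_ofNat]; ring⟩
  · exact ⟨0, 1, -s, by simp⟩
  · exact ⟨0, 0, 1, by simp⟩

lemma span_triple_symm (a b c : MvPolynomial (Fin 3) ℂ) :
    Submodule.span ℂ {c, b, a} = Submodule.span ℂ {a, b, c} := by
  congr 1; ext; simp; tauto

lemma span_triple_scale (a b c : MvPolynomial (Fin 3) ℂ) {k : ℂ} (hk : k ≠ 0) :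
    Submodule.span ℂ {C k * a, b, C k⁻¹ * c} = Submodule.span ℂ {a, b, c} := by
  refine le_antisymm (span_triple_le ?_ ?_ ?_) (span_triple_le ?_ ?_ ?_) <;>
    rw [mem_span_triple_iff]
  · exact ⟨k, 0, 0, by simp⟩
  · exact ⟨0, 1, 0, by simp⟩
  · exact ⟨0, 0, k⁻¹, by simp⟩
  · exact ⟨k⁻¹, 0, 0, by simp [← mul_assoc, ← map_mul, hk]⟩
  · exact ⟨0, 1, 0, by simp⟩
  · exact ⟨0, 0, k, by simp [← mul_assoc, ← map_mul, hk]⟩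

lemma quadHess_shift (a b c : MvPolynomial (Fin 3) ℂ) (s : ℂ) :
    quadHess (a + C (2 * s) * b + C (s ^ 2) * c) =
      quadHess a + (2 * s) • quadHess b + s ^ 2 • quadHess c := by
  simp only [quadHess_add, quadHess_C_mul]

lemma IsSmoothForm.exists_det_ne_zero {f a b c : MvPolynomial (Fin 3) ℂ} (hf : IsSmoothForm f)
    (h : IsConicRep f a b c) : ∃ a' b' c', IsConicRep f a' b' c' ∧ (quadHess c').det ≠ 0 ∧
      Submodule.span ℂ {a', b', c'} = Submodule.span ℂ {a, b, c} := by
  obtain ⟨p, -, -, hp, hp'⟩ := exists_det_polynomial (quadHess a) (quadHess b) (quadHess c)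
  by_cases hs : ∀ s, p.eval s = 0
  · have hp0 : p = 0 := Polynomial.funext (by simpa using hs)
    have h0 : (quadHess a).det = 0 := by simpa [hp0] using (hp 0).symm
    exact absurd (by simpa [hp0] using (hp' 0).symm) (hf.trace_adjugate_ne_zero h h0)
  · push Not at hs
    obtain ⟨s, hs⟩ := hs
    refine ⟨_, _, _, (h.shift s).symm, by rwa [quadHess_shift, ← hp], ?_⟩
    rw [span_triple_symm, span_triple_shift]

lemma IsSmoothForm.exists_six_singular {f a b c : MvPolynomial (Fin 3) ℂ} (hf : IsSmoothForm f)
    (h : IsConicRep f a b c) (hc : (quadHess c).det ≠ 0) : ∃ R : Finset ℂ, R.card = 6 ∧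
      ∀ s, s ∈ R ↔ (quadHess (a + C (2 * s) * b + C (s ^ 2) * c)).det = 0 := by
  obtain ⟨p, hdeg, hcoef, hp, hp'⟩ := exists_det_polynomial (quadHess a) (quadHess b) (quadHess c)
  have hnat : p.natDegree = 6 := le_antisymm hdeg (Polynomial.le_natDegree_of_ne_zero (hcoef ▸ hc))
  have hp0 : p ≠ 0 := by rintro rfl; simp at hnat
  have hnodup : p.roots.Nodup := by
    rw [Multiset.nodup_iff_count_le_one]
    intro s
    rw [Polynomial.count_roots]
    by_contra! hlt
    obtain ⟨h1, h2⟩ := (Polynomial.one_lt_rootMultiplicity_iff_isRoot hp0).mp hlt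
    rw [Polynomial.IsRoot, hp', ← quadHess_shift, ← quadHess_C_mul, ← quadHess_add] at h2
    rw [Polynomial.IsRoot, hp, ← quadHess_shift] at h1
    exact hf.trace_adjugate_ne_zero (h.shift s) h1 (by simpa using h2)
  refine ⟨p.roots.toFinset, ?_, fun s => ?_⟩
  · rw [Multiset.toFinset_card_of_nodup hnodup, ← hnat]
    exact (IsAlgClosed.splits p).natDegree_eq_card_roots.symm
  · rw [Multiset.mem_toFinset, Polynomial.mem_roots hp0, Polynomial.IsRoot, hp, quadHess_shift]

/-- Isotropic members of the span of a conic representation. -/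
lemma IsSmoothForm.isotropic {f a b c a' b' c' : MvPolynomial (Fin 3) ℂ} (hf : IsSmoothForm f)
    (h : IsConicRep f a b c) (h' : IsConicRep f a' b' c')
    (hle : Submodule.span ℂ {a', b', c'} ≤ Submodule.span ℂ {a, b, c}) :
    ∃ x y z : ℂ, a' = C x * a + C y * b + C z * c ∧ y ^ 2 = 4 * x * z := by
  have hmem {q} (hq : q ∈ ({a', b', c'} : Set (MvPolynomial (Fin 3) ℂ))) :=
    mem_span_triple_iff.mp (hle (Submodule.subset_span hq))
  obtain ⟨x₁, y₁, z₁, ha⟩ := hmem (q := a') (by simp)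
  obtain ⟨x₂, y₂, z₂, hb⟩ := hmem (q := b') (by simp)
  obtain ⟨x₃, y₃, z₃, hc⟩ := hmem (q := c') (by simp)
  obtain ⟨h1, h2, h3, h4, h5, h6⟩ := hf.no_quadratic_relation h.eq h.left h.mid h.right
    (α := x₁ * x₃ - x₂ ^ 2) (β := y₁ * y₃ - y₂ ^ 2 + 1) (γ := z₁ * z₃ - z₂ ^ 2)
    (δ := x₁ * y₃ + y₁ * x₃ - 2 * x₂ * y₂) (ε := y₁ * z₃ + z₁ * y₃ - 2 * y₂ * z₂)
    (ζ := x₁ * z₃ + z₁ * x₃ - 2 * x₂ * z₂ - 1) (by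
      have := h.eq.symm.trans h'.eq
      rw [ha, hb, hc] at this
      simp only [map_add, map_sub, map_mul, map_pow, map_ofNat, map_one]
      linear_combination -this)
  refine ⟨x₁, y₁, z₁, ha, ?_⟩
  let M : Matrix (Fin 3) (Fin 3) ℂ := !![x₁, y₁, z₁; x₂, y₂, z₂; x₃, y₃, z₃]
  let N : Matrix (Fin 3) (Fin 3) ℂ := !![z₃, -2 * z₂, z₁; -y₃ / 2, y₂, -y₁ / 2; x₃, -2 * x₂, x₁]
  have hNM : N * M = 1 := by
    ext i j
    fin_cases i <;> fin_cases j <;> simp [N, M, mul_apply, Fin.sum_univ_three] <;> grind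
  have h02 : (M * N) 0 2 = 0 := by rw [mul_eq_one_comm.mp hNM]; rfl
  simp [N, M, mul_apply, Fin.sum_univ_three] at h02
  linear_combination -2 * h02

lemma exists_proportional_of_cross_eq_zero {l m : Fin 3 → ℂ} (hl : l ≠ 0) (hm : m ≠ 0)
    (h : crossProduct l m = 0) : ∃ k : ℂ, k ≠ 0 ∧ linForm m = C k * linForm l := by
  obtain ⟨k, rfl⟩ := (cross_eq_zero_iff hl).mp h
  exact ⟨k, by rintro rfl; simp at hm, by rw [linForm_smul]⟩

section
variable {f : MvPolynomial (Fin 3) ℂ} {T : Finset (Fin 3 → ℂ)}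

/-- A set of representatives of the bitangents of `f`. -/
structure IsBitangentSystem (f : MvPolynomial (Fin 3) ℂ) (T : Finset (Fin 3 → ℂ)) : Prop where
  ne_zero : ∀ l ∈ T, l ≠ 0
  isBitangent : ∀ l ∈ T, IsBitangent f l
  cross_ne_zero : ∀ l ∈ T, ∀ m ∈ T, l ≠ m → crossProduct l m ≠ 0
  exists_cross_eq_zero : ∀ l, l ≠ 0 → IsBitangent f l → ∃ m ∈ T, crossProduct l m = 0

/-- The spans of the conic representations of `f`. -/
def conicSpans (f : MvPolynomial (Fin 3) ℂ) : Set (Submodule ℂ (MvPolynomial (Fin 3) ℂ)) :=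
  {V | ∃ a b c, IsConicRep f a b c ∧ Submodule.span ℂ {a, b, c} = V}

/-- `V` is spanned by a conic representation of `f` whose first member is `q`. -/
def SpansWith (f q : MvPolynomial (Fin 3) ℂ) (V : Submodule ℂ (MvPolynomial (Fin 3) ℂ)) : Prop :=
  ∃ b c, IsConicRep f q b c ∧ Submodule.span ℂ {q, b, c} = V

lemma SpansWith.eq (hs : IsSmoothForm f) {l m : Fin 3 → ℂ}
    {V W : Submodule ℂ (MvPolynomial (Fin 3) ℂ)} (hV : SpansWith f (linForm l * linForm m) V)
    (hW : SpansWith f (linForm l * linForm m) W) : V = W := by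
  obtain ⟨b, c, h, rfl⟩ := hV
  obtain ⟨b', c', h', rfl⟩ := hW
  exact le_antisymm (hs.span_eq_span h' h) (hs.span_eq_span h h')

lemma SpansWith.scale {q : MvPolynomial (Fin 3) ℂ} {V : Submodule ℂ (MvPolynomial (Fin 3) ℂ)}
    (h : SpansWith f q V) {k : ℂ} (hk : k ≠ 0) : SpansWith f (C k * q) V := by
  obtain ⟨b, c, h, rfl⟩ := h
  exact ⟨b, _, h.scale hk, span_triple_scale q b c hk⟩

lemma linForm_mul_det_quadHess (l m : Fin 3 → ℂ) : (quadHess (linForm l * linForm m)).det = 0 := by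
  have h (x : Fin 3 → ℂ) (hl : l ⬝ᵥ x = 0) (hm : m ⬝ᵥ x = 0) :
      quadHess (linForm l * linForm m) *ᵥ x = 0 := by
    ext i
    rw [← eval_pderiv_of_isHomogeneous_two ((isHomogeneous_linForm l).mul (isHomogeneous_linForm m)),
      eval_pderiv_linForm_mul hl hm]
    rfl
  refine exists_mulVec_eq_zero_iff.mp ?_
  by_cases hlm : crossProduct l m = 0
  · obtain ⟨x, hx, hlx, -⟩ := exists_eval_eq_zero_on_line (isHomogeneous_zero _ _ 2)
      (if l = 0 then m else l)
    by_cases hl : l = 0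
    · exact ⟨x, hx, h x (by simp [hl]) (by simpa [hl] using hlx)⟩
    · obtain ⟨k, rfl⟩ := (cross_eq_zero_iff hl).mp hlm
      rw [if_neg hl] at hlx
      exact ⟨x, hx, h x hlx (by simp [hlx])⟩
  · exact ⟨_, hlm, h _ (dot_self_cross l m) (dot_cross_self l m)⟩

variable (hT : IsBitangentSystem f T)
include hT

lemma IsBitangentSystem.mem_of_dvd {l : Fin 3 → ℂ} (hl : l ∈ T) {s : Finset (Fin 3 → ℂ)}
    (hsT : s ⊆ T) {k : ℂ} (hk : k ≠ 0) (h : linForm l ∣ C k * ∏ m ∈ s, linForm m) : l ∈ s := by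
  rcases linForm_dvd_or_dvd (hT.ne_zero l hl) h with h | h
  · exfalso
    obtain ⟨i, hi⟩ : ∃ x, x ≠ 0 ∧ l ⬝ᵥ x = 0 := by
      obtain ⟨x, hx, hlx, -⟩ := exists_eval_eq_zero_on_line (isHomogeneous_zero _ _ 2) l
      exact ⟨x, hx, hlx⟩
    simpa [hk] using eval_eq_zero_of_linForm_dvd h hi.2
  · induction s using Finset.cons_induction with
    | empty =>
      exfalso
      obtain ⟨x, -, hlx, -⟩ := exists_eval_eq_zero_on_line (isHomogeneous_zero _ _ 2) l
      simpa using eval_eq_zero_of_linForm_dvd h hlx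
    | cons m s hm ih =>
      rw [Finset.prod_cons] at h
      rw [Finset.mem_cons]
      rcases linForm_dvd_or_dvd (hT.ne_zero l hl) h with h' | h'
      · left
        by_contra hne
        exact hT.cross_ne_zero l hl m (hsT (Finset.mem_cons_self m s)) hne (linForm_dvd_linForm h')
      · exact .inr (ih ((Finset.subset_cons hm).trans hsT) (h'.mul_left _) h')

lemma IsBitangentSystem.eq_of_prod_eq {s t : Finset (Fin 3 → ℂ)} (hs : s ∈ T.powersetCard 2)
    (ht : t ∈ T.powersetCard 2) {k : ℂ} (hk : k ≠ 0)
    (h : ∏ l ∈ s, linForm l = C k * ∏ l ∈ t, linForm l) : s = t := by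
  rw [Finset.mem_powersetCard] at hs ht
  refine Finset.eq_of_subset_of_card_le (fun l hl => hT.mem_of_dvd (hs.1 hl) ht.1 hk ?_)
    (by rw [hs.2, ht.2])
  rw [← h]
  exact Finset.dvd_prod_of_mem _ hl

lemma IsBitangentSystem.exists_spansWith (hf : f.IsHomogeneous 4) {s : Finset (Fin 3 → ℂ)}
    (hs : s ∈ T.powersetCard 2) : ∃ V, SpansWith f (∏ l ∈ s, linForm l) V := by
  obtain ⟨hsT, hcard⟩ := Finset.mem_powersetCard.mp hs
  obtain ⟨l, m, hlm, rfl⟩ := Finset.card_eq_two.mp hcard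
  have hl : l ∈ T := hsT (by simp)
  have hm : m ∈ T := hsT (by simp)
  obtain ⟨b, c, h⟩ := exists_conicRep_of_isBitangent hf (hT.cross_ne_zero l hl m hm hlm)
    (hT.isBitangent l hl) (hT.isBitangent m hm)
  rw [Finset.prod_pair hlm]
  exact ⟨_, b, c, h, rfl⟩

lemma IsBitangentSystem.exists_pair (hf : IsSmoothForm f) {q b c : MvPolynomial (Fin 3) ℂ}
    (h : IsConicRep f q b c) (hq : (quadHess q).det = 0) :
    ∃ s ∈ T.powersetCard 2, ∃ k : ℂ, k ≠ 0 ∧ ∏ l ∈ s, linForm l = C k * q := by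
  obtain ⟨e, he, he0⟩ := exists_mulVec_eq_zero_iff.mpr hq
  obtain ⟨l, m, rfl⟩ := exists_factor_of_mulVec_eq_zero h.left he he0
  have hlm := hf.cross_ne_zero h
  have hl0 : l ≠ 0 := by rintro rfl; simp at hlm
  have hm0 : m ≠ 0 := by rintro rfl; simp at hlm
  obtain ⟨l', hl', hll⟩ := hT.exists_cross_eq_zero l hl0 (isBitangent_of_dvd h (dvd_mul_right _ _))
  obtain ⟨m', hm', hmm⟩ := hT.exists_cross_eq_zero m hm0 (isBitangent_of_dvd h (dvd_mul_left _ _))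
  obtain ⟨k, hk, hkl⟩ := exists_proportional_of_cross_eq_zero hl0 (hT.ne_zero l' hl') hll
  obtain ⟨k', hk', hkm⟩ := exists_proportional_of_cross_eq_zero hm0 (hT.ne_zero m' hm') hmm
  have hne : l' ≠ m' := by
    rintro rfl
    obtain ⟨a, rfl⟩ := (cross_eq_zero_iff hl0).mp hll
    rw [cross_eq_zero_iff hm0] at hmm
    obtain ⟨a', ha'⟩ := hmm
    have ha : a ≠ 0 := by rintro rfl; exact hT.ne_zero _ hl' (by simp)
    refine hlm ((cross_eq_zero_iff hl0).mpr ⟨a'⁻¹ * a, ?_⟩)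
    have ha0 : a' ≠ 0 := by rintro rfl; simp [ha, hl0] at ha'
    rw [mul_smul, ha', smul_smul, inv_mul_cancel₀ ha0, one_smul]
  refine ⟨{l', m'}, ?_, k * k', mul_ne_zero hk hk', ?_⟩
  · simp [Finset.mem_powersetCard, Finset.insert_subset_iff, hl', hm', Finset.card_pair hne]
  · rw [Finset.prod_pair hne, hkl, hkm, map_mul]; ring

open Classical in
lemma IsBitangentSystem.card_fiber (hf : IsSmoothForm f)
    {V : Submodule ℂ (MvPolynomial (Fin 3) ℂ)} (hV : V ∈ conicSpans f) :
    ((T.powersetCard 2).filter fun s => SpansWith f (∏ l ∈ s, linForm l) V).card = 6 := by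
  obtain ⟨a₀, b₀, c₀, h₀, rfl⟩ := hV
  obtain ⟨a, b, c, h, hdet, hspan⟩ := hf.exists_det_ne_zero h₀
  rw [← hspan]
  obtain ⟨R, hR, hmem⟩ := hf.exists_six_singular h hdet
  rw [← hR]
  have hind {k x y z : ℂ} (hxyz : C k * (C x * a + C y * b + C z * c) = 0) (hk : k ≠ 0) :
      x = 0 ∧ y = 0 ∧ z = 0 := by
    rw [mul_eq_zero, map_eq_zero_iff _ (C_injective _ _)] at hxyz
    exact hf.no_linear_relation h.eq h.left h.mid h.right (hxyz.resolve_left hk)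
  have key := Finset.card_mul_eq_card_mul (m := 1) (n := 1)
    (s := (T.powersetCard 2).filter fun s => SpansWith f (∏ l ∈ s, linForm l)
      (Submodule.span ℂ {a, b, c})) (t := R)
    (fun s r => ∃ k : ℂ, k ≠ 0 ∧ ∏ l ∈ s, linForm l = C k * (a + C (2 * r) * b + C (r ^ 2) * c))
    (fun s hs => ?_) (fun r hr => ?_)
  · simpa using key
  · rw [Finset.mem_filter] at hs
    obtain ⟨hs, b', c', h', hspan'⟩ := hs
    obtain ⟨hsT, hcard⟩ := Finset.mem_powersetCard.mp hs
    obtain ⟨l, m, hlm, rfl⟩ := Finset.card_eq_two.mp hcard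
    have hprod := Finset.prod_pair (f := linForm) hlm
    rw [hprod] at h' hspan'
    obtain ⟨x, y, z, hxyz, hiso⟩ := hf.isotropic h h' hspan'.le
    have hx : x ≠ 0 := by
      rintro rfl
      have hy : y = 0 := by simpa using hiso
      have hd := linForm_mul_det_quadHess l m
      rw [hxyz, hy, map_zero, zero_mul, zero_mul, zero_add, zero_add, quadHess_C_mul, det_smul] at hd
      have hz : z = 0 := by simpa [hdet] using hd
      rw [hy, hz] at hxyz
      exact mul_ne_zero (linForm_ne_zero (hT.ne_zero l (hsT (by simp))))
        (linForm_ne_zero (hT.ne_zero m (hsT (by simp)))) (by simpa using hxyz)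
    have hxr : ∏ l ∈ {l, m}, linForm l =
        C x * (a + C (2 * (y / (2 * x))) * b + C ((y / (2 * x)) ^ 2) * c) := by
      rw [hprod, hxyz, mul_add, mul_add, ← mul_assoc, ← mul_assoc, ← map_mul, ← map_mul]
      congr 3
      · field_simp
      · field_simp; linear_combination -hiso
    rw [Finset.card_eq_one]
    refine ⟨y / (2 * x), Finset.ext fun r => ?_⟩
    rw [Finset.mem_bipartiteAbove, Finset.mem_singleton]
    constructor
    · rintro ⟨-, k, hk, hkr⟩
      obtain ⟨h1, h2, -⟩ := hind (k := 1) (x := x - k) (y := y - k * (2 * r)) (z := z - k * r ^ 2)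
        (by
          rw [hprod, hxyz] at hkr
          simp only [map_sub, map_mul, map_pow, map_ofNat, map_one] at hkr ⊢
          linear_combination hkr) one_ne_zero
      obtain rfl := sub_eq_zero.mp h1
      field_simp
      linear_combination -h2
    · rintro rfl
      refine ⟨(hmem _).mpr ?_, x, hx, hxr⟩
      have hd := linForm_mul_det_quadHess l m
      rw [← hprod, hxr, quadHess_C_mul, det_smul] at hd
      exact (mul_eq_zero.mp hd).resolve_left (pow_ne_zero _ hx)
  · obtain ⟨s, hs, k, hk, hsk⟩ := hT.exists_pair hf (h.shift r) ((hmem r).mp hr)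
    rw [Finset.card_eq_one]
    refine ⟨s, Finset.ext fun t => ?_⟩
    rw [Finset.mem_bipartiteBelow, Finset.mem_singleton, Finset.mem_filter]
    constructor
    · rintro ⟨⟨ht, -⟩, k', hk', htk⟩
      refine hT.eq_of_prod_eq ht hs (k := k' * k⁻¹) (by positivity) ?_
      rw [htk, hsk, ← mul_assoc, ← map_mul]
      congr 2
      field_simp
    · rintro rfl
      refine ⟨⟨hs, ?_⟩, k, hk, hsk⟩
      rw [hsk]
      exact SpansWith.scale ⟨_, _, h.shift r, span_triple_shift a b c r⟩ hk

open Classical in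
lemma IsBitangentSystem.ncard_conicSpans (hf : f.IsHomogeneous 4) (hs : IsSmoothForm f) :
    6 * (conicSpans f).ncard = T.card.choose 2 := by
  have hex (s : Finset (Fin 3 → ℂ)) : ∃ V, s ∈ T.powersetCard 2 →
      SpansWith f (∏ l ∈ s, linForm l) V := by
    by_cases h : s ∈ T.powersetCard 2
    · exact (hT.exists_spansWith hf h).imp fun _ hV _ => hV
    · exact ⟨⊥, fun h' => absurd h' h⟩
  choose φ hφ using hex
  have hiff {s V} (hsT : s ∈ T.powersetCard 2) : φ s = V ↔ SpansWith f (∏ l ∈ s, linForm l) V := by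
    refine ⟨fun h => h ▸ hφ s hsT, fun h => ?_⟩
    have h' := hφ s hsT
    obtain ⟨l, m, hlm, rfl⟩ := Finset.card_eq_two.mp (Finset.mem_powersetCard.mp hsT).2
    rw [Finset.prod_pair hlm] at h h'
    exact h'.eq hs h
  have hfib {V} (hV : V ∈ conicSpans f) : ((T.powersetCard 2).filter fun s => φ s = V).card = 6 := by
    rw [← hT.card_fiber hs hV]
    congr 1
    exact Finset.filter_congr fun s hsT => hiff hsT
  have himage : conicSpans f = (T.powersetCard 2).image φ := by
    ext V
    simp only [Finset.coe_image, Set.mem_image, Finset.mem_coe]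
    constructor
    · intro hV
      have : ((T.powersetCard 2).filter fun s => φ s = V).Nonempty := by
        rw [← Finset.card_pos, hfib hV]; norm_num
      obtain ⟨s, hs⟩ := this
      rw [Finset.mem_filter] at hs
      exact ⟨s, hs⟩
    · rintro ⟨s, hsT, rfl⟩
      obtain ⟨b, c, h⟩ := hφ s hsT
      exact ⟨_, b, c, h⟩
  rw [← Finset.card_powersetCard, Finset.card_eq_sum_card_image φ, himage, Set.ncard_coe_finset,
    Finset.sum_const_nat (m := 6), mul_comm]
  intro V hV
  exact hfib (by rw [himage]; exact hV)

end

lemma isConicRep_of_quadRep {f p q r : MvPolynomial (Fin 3) ℂ} (hp : p.IsHomogeneous 2)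
    (hq : q.IsHomogeneous 2) (hr : r.IsHomogeneous 2) (h : f = p ^ 2 + q ^ 2 + r ^ 2) :
    IsConicRep f (p + C Complex.I * q) (C Complex.I * r) (p - C Complex.I * q) ∧
      Submodule.span ℂ {p + C Complex.I * q, C Complex.I * r, p - C Complex.I * q} =
        Submodule.span ℂ {p, q, r} := by
  have hI : (C Complex.I : MvPolynomial (Fin 3) ℂ) ^ 2 = -1 := by
    rw [← map_pow, Complex.I_sq, map_neg, map_one]
  have h2 : (C (1 / 2) * 2 : MvPolynomial (Fin 3) ℂ) = 1 := by
    rw [← map_ofNat C, ← map_mul]; norm_num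
  refine ⟨⟨hp.add (hq.C_mul _), hr.C_mul _, hp.sub (hq.C_mul _), ?_⟩,
    le_antisymm (span_triple_le ?_ ?_ ?_) (span_triple_le ?_ ?_ ?_)⟩
  · linear_combination h + (q ^ 2 + r ^ 2) * hI
  all_goals rw [mem_span_triple_iff]
  · exact ⟨1, Complex.I, 0, by simp⟩
  · exact ⟨0, 0, Complex.I, by simp⟩
  · exact ⟨1, -Complex.I, 0, by simp; ring⟩
  · exact ⟨1 / 2, 0, 1 / 2, by rw [map_zero]; linear_combination -p * h2⟩
  · refine ⟨-Complex.I * (1 / 2), 0, Complex.I * (1 / 2), ?_⟩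
    simp only [map_mul, map_neg, map_zero]
    linear_combination -q * h2 + 2 * C (1 / 2) * q * hI
  · exact ⟨0, -Complex.I, 0, by simp only [map_neg, map_zero]; linear_combination r * hI⟩

lemma card_quotient_quadRep (f : MvPolynomial (Fin 3) ℂ) :
    Nat.card (Quotient (QuadRepSetoid f)) = (conicSpans f).ncard := by
  rw [← Nat.card_coe_set_eq]
  refine Nat.card_congr ((Setoid.quotientKerEquivRange _).trans (Equiv.setCongr ?_))
  ext V
  constructor
  · rintro ⟨⟨⟨p, q, r⟩, hp, hq, hr, h⟩, rfl⟩
    obtain ⟨h1, h2⟩ := isConicRep_of_quadRep hp hq hr h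
    exact ⟨_, _, _, h1, h2⟩
  · rintro ⟨a, b, c, h, rfl⟩
    have hI : (C Complex.I : MvPolynomial (Fin 3) ℂ) ^ 2 = -1 := by
      rw [← map_pow, Complex.I_sq, map_neg, map_one]
    have h2 : (C (1 / 2) * 2 : MvPolynomial (Fin 3) ℂ) = 1 := by
      rw [← map_ofNat C, ← map_mul]; norm_num
    have ha := h.left
    have hb := h.mid
    have hc := h.right
    have hp : (C (1 / 2) * (a + c)).IsHomogeneous 2 := (ha.add hc).C_mul _
    have hq : (C (-Complex.I) * (C (1 / 2) * (a - c))).IsHomogeneous 2 :=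
      ((ha.sub hc).C_mul _).C_mul _
    have hr : (C (-Complex.I) * b).IsHomogeneous 2 := hb.C_mul _
    have e1 : C (1 / 2) * (a + c) + C Complex.I * (C (-Complex.I) * (C (1 / 2) * (a - c))) = a := by
      simp only [map_neg]
      linear_combination a * h2 - C (1 / 2) * (a - c) * hI
    have e2 : C Complex.I * (C (-Complex.I) * b) = b := by
      simp only [map_neg]
      linear_combination - b * hI
    have e3 : C (1 / 2) * (a + c) - C Complex.I * (C (-Complex.I) * (C (1 / 2) * (a - c))) = c := by
      simp only [map_neg]
      linear_combination c * h2 + C (1 / 2) * (a - c) * hI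
    have hfr : f = (C (1 / 2) * (a + c)) ^ 2 + (C (-Complex.I) * (C (1 / 2) * (a - c))) ^ 2 +
        (C (-Complex.I) * b) ^ 2 := by
      simp only [map_neg]
      linear_combination h.eq - ((C (1 / 2) * (a - c)) ^ 2 + b ^ 2) * hI -
        a * c * (C (1 / 2) * 2 + 1) * h2
    refine ⟨⟨(_, _, _), hp, hq, hr, hfr⟩, ?_⟩
    have := (isConicRep_of_quadRep hp hq hr hfr).2
    rw [e1, e2, e3] at this
    exact this.symm

section
open Filter Topology

variable {E : Type*} [NormedAddCommGroup E] [NormedSpace ℂ E] [FiniteDimensional ℂ E]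
  {Φ : ℂ × E → E} {s₀ : ℂ}

/-- Local description of the zeros of an analytic family of square systems near a simple zero. -/
lemma exists_local_zero (hΦ : ∀ p, AnalyticAt ℂ Φ p) {x : E} (hx : Φ (s₀, x) = 0)
    (hinj : ∀ v, fderiv ℂ Φ (s₀, x) (0, v) = 0 → v = 0) :
    ∃ ψ : ℂ → E, ψ s₀ = x ∧ Tendsto ψ (𝓝 s₀) (𝓝 x) ∧
      ∀ᶠ p in 𝓝 (s₀, x), Φ p = 0 ↔ ψ p.1 = p.2 := by
  have : CompleteSpace E := FiniteDimensional.complete ℂ E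
  have hd := (hΦ (s₀, x)).hasStrictFDerivAt
  have hinv : (fderiv ℂ Φ (s₀, x) ∘L .inr ℂ ℂ E).IsInvertible := by
    let e := LinearEquiv.ofInjectiveEndo ((fderiv ℂ Φ (s₀, x) ∘L .inr ℂ ℂ E : E →L[ℂ] E) : E →ₗ[ℂ] E)
      ((injective_iff_map_eq_zero _).mpr fun v hv => hinj v (by simpa using hv))
    exact ⟨e.toContinuousLinearEquiv, by ext v; rfl⟩
  have h := hd.eventually_apply_eq_iff_implicitFunctionOfProdDomain hinv
  rw [hx] at h
  exact ⟨_, h.self_of_nhds.mp hx, hd.tendsto_implicitFunctionOfProdDomain hinv, h⟩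

lemma eventually_unique_zero (hΦ : ∀ p, AnalyticAt ℂ Φ p)
    (hinj : ∀ x, Φ (s₀, x) = 0 → ∀ v, fderiv ℂ Φ (s₀, x) (0, v) = 0 → v = 0) (x : E) :
    ∀ᶠ y in 𝓝 x, Φ (s₀, y) = 0 → y = x := by
  have hc : Tendsto (fun y => (s₀, y)) (𝓝 x) (𝓝 (s₀, x)) := (Continuous.prodMk_right s₀).tendsto x
  by_cases hx : Φ (s₀, x) = 0
  · obtain ⟨ψ, h1, -, h2⟩ := exists_local_zero hΦ hx (hinj x hx)
    filter_upwards [hc.eventually h2] with y hy hy0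
    rw [← hy.mp hy0, h1]
  · filter_upwards [hc.eventually ((hΦ (s₀, x)).continuousAt.eventually_ne hx)] with y hy hy0
    exact absurd hy0 hy

lemma countable_zeros (hΦ : ∀ p, AnalyticAt ℂ Φ p)
    (hinj : ∀ x, Φ (s₀, x) = 0 → ∀ v, fderiv ℂ Φ (s₀, x) (0, v) = 0 → v = 0) :
    {x | Φ (s₀, x) = 0}.Countable := by
  have : ProperSpace E := FiniteDimensional.proper ℂ E
  obtain ⟨t, ht, hU⟩ := TopologicalSpace.countable_cover_nhds
    (f := fun x => {y | Φ (s₀, y) = 0 → y = x}) (fun x => eventually_unique_zero hΦ hinj x)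
  refine ht.mono fun y hy => ?_
  obtain ⟨x, hx, hyx⟩ := Set.mem_iUnion₂.mp (hU.ge (Set.mem_univ y))
  rwa [hyx hy]

lemma eventually_ncard_zeros (hΦ : ∀ p, AnalyticAt ℂ Φ p)
    (hinj : ∀ x, Φ (s₀, x) = 0 → ∀ v, fderiv ℂ Φ (s₀, x) (0, v) = 0 → v = 0) {K : Set E}
    (hK : IsCompact K) (hZK : ∀ᶠ s in 𝓝 s₀, ∀ x, Φ (s, x) = 0 → x ∈ K) :
    ∃ n, ∀ᶠ s in 𝓝 s₀, {x | Φ (s, x) = 0}.Finite ∧ {x | Φ (s, x) = 0}.ncard = n := by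
  have hfin : {x | Φ (s₀, x) = 0}.Finite := by
    obtain ⟨t, -, ht⟩ := hK.elim_nhds_subcover (fun x => {y | Φ (s₀, y) = 0 → y = x})
      (fun x _ => eventually_unique_zero hΦ hinj x)
    refine t.finite_toSet.subset fun y hy => ?_
    obtain ⟨x, hx, hyx⟩ := Set.mem_iUnion₂.mp (ht (hZK.self_of_nhds y hy))
    rwa [hyx hy]
  have hloc (x : E) : ∃ ψ : ℂ → E, Φ (s₀, x) = 0 → ψ s₀ = x ∧ Tendsto ψ (𝓝 s₀) (𝓝 x) ∧
      ∀ᶠ p in 𝓝 (s₀, x), Φ p = 0 ↔ ψ p.1 = p.2 := by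
    by_cases hx : Φ (s₀, x) = 0
    · exact (exists_local_zero hΦ hx (hinj x hx)).imp fun _ h _ => h
    · exact ⟨0, fun h => absurd h hx⟩
  choose ψ hψ using hloc
  have hzero : ∀ᶠ s in 𝓝 s₀, ∀ x ∈ {x | Φ (s₀, x) = 0}, Φ (s, ψ x s) = 0 := by
    rw [eventually_all_finite hfin]
    intro x hx
    obtain ⟨-, h2, h3⟩ := hψ x hx
    have ht : Tendsto (fun s => (s, ψ x s)) (𝓝 s₀) (𝓝 (s₀, x)) := tendsto_id.prodMk_nhds h2
    filter_upwards [ht.eventually h3] with s hs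
    exact hs.mpr rfl
  have hne : ∀ᶠ s in 𝓝 s₀, ∀ x ∈ {x | Φ (s₀, x) = 0}, ∀ y ∈ {x | Φ (s₀, x) = 0},
      ψ x s = ψ y s → x = y := by
    rw [eventually_all_finite hfin]
    intro x hx
    rw [eventually_all_finite hfin]
    intro y hy
    by_cases hxy : x = y
    · simp [hxy]
    · filter_upwards [((hψ x hx).2.1.prodMk_nhds (hψ y hy).2.1).eventually
        (isClosed_diagonal.isOpen_compl.mem_nhds (show (x, y) ∈ (Set.diagonal E)ᶜ from hxy))] with s hs h
      exact absurd h hs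
  have hsurj : ∀ᶠ s in 𝓝 s₀, ∀ y ∈ K, Φ (s, y) = 0 → ∃ x, Φ (s₀, x) = 0 ∧ ψ x s = y := by
    refine hK.eventually_forall_of_forall_eventually fun y _ => ?_
    by_cases hy : Φ (s₀, y) = 0
    · filter_upwards [(hψ y hy).2.2] with p hp hp0
      exact ⟨y, hy, hp.mp hp0⟩
    · filter_upwards [(hΦ (s₀, y)).continuousAt.eventually_ne hy] with p hp hp0
      exact absurd hp0 hp
  refine ⟨{x | Φ (s₀, x) = 0}.ncard, ?_⟩
  filter_upwards [hzero, hne, hsurj, hZK] with s h1 h2 h3 h4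
  have himage : {x | Φ (s, x) = 0} = (fun x => ψ x s) '' {x | Φ (s₀, x) = 0} := by
    ext y
    constructor
    · intro hy
      exact h3 y (h4 y hy) hy
    · rintro ⟨x, hx, rfl⟩
      exact h1 x hx
  rw [himage]
  exact ⟨hfin.image _, Set.InjOn.ncard_image fun x hx y hy h => h2 x hx y hy h⟩

end

lemma exists_binary_coeff {p : MvPolynomial (Fin 3) ℂ} {d : ℕ} (hp : p.IsHomogeneous d) :
    ∃ e : ℕ → ℂ, ∀ x y, eval ![x, y, 0] p = ∑ i ∈ Finset.range (d + 1), e i * x ^ i * y ^ (d - i) := by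
  refine ⟨fun i => ∑ m ∈ p.support, if m 0 = i then coeff m p * 0 ^ m 2 else 0, fun x y => ?_⟩
  simp only [Finset.sum_mul]
  rw [Finset.sum_comm, eval_eq']
  refine Finset.sum_congr rfl fun m hm => ?_
  have hd : m 0 + m 1 + m 2 = d := by
    have := hp (mem_support_iff.mp hm)
    simpa [Finsupp.weight_apply, Finsupp.sum_fintype, Fin.sum_univ_three] using this
  simp only [ite_mul, zero_mul, Finset.sum_ite_eq, Finset.mem_range, Fin.prod_univ_three,
    Matrix.cons_val_zero, Matrix.cons_val_one, Matrix.cons_val_two, Matrix.head_cons,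
    Matrix.tail_cons]
  rw [if_pos (by omega)]
  rcases Nat.eq_zero_or_pos (m 2) with h | h
  · rw [h, show d - m 0 = m 1 by omega]
    ring
  · rw [zero_pow h.ne']
    ring

lemma eval_binary_eq_zero {p : MvPolynomial (Fin 3) ℂ} (hp : p.IsHomogeneous 4)
    (h : ∀ k : Fin 5, eval ![1, (k : ℂ), 0] p = 0) (x y : ℂ) : eval ![x, y, 0] p = 0 := by
  obtain ⟨e, he⟩ := exists_binary_coeff hp
  simp only [Finset.sum_range_succ, Finset.sum_range_zero] at he
  have h0 := h 0
  have h1 := h 1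
  have h2 := h 2
  have h3 := h 3
  have h4 := h 4
  rw [he] at h0 h1 h2 h3 h4 ⊢
  norm_num at h0 h1 h2 h3 h4
  have e0 : e 0 = 0 := by
    linear_combination (1 / 24 : ℂ) * h4 - (1 / 6 : ℂ) * h3 + (1 / 4 : ℂ) * h2 - (1 / 6 : ℂ) * h1
      + (1 / 24 : ℂ) * h0
  have e1 : e 1 = 0 := by
    linear_combination -(1 / 4 : ℂ) * h4 + (7 / 6 : ℂ) * h3 - 2 * h2 + (3 / 2 : ℂ) * h1
      - (5 / 12 : ℂ) * h0
  have e2 : e 2 = 0 := by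
    linear_combination (11 / 24 : ℂ) * h4 - (7 / 3 : ℂ) * h3 + (19 / 4 : ℂ) * h2 - (13 / 3 : ℂ) * h1
      + (35 / 24 : ℂ) * h0
  have e3 : e 3 = 0 := by
    linear_combination -(1 / 4 : ℂ) * h4 + (4 / 3 : ℂ) * h3 - 3 * h2 + 4 * h1 - (25 / 12 : ℂ) * h0
  have e4 : e 4 = 0 := by linear_combination h0
  simp [e0, e1, e2, e3, e4]

lemma exists_binary_cubic_zero {p : MvPolynomial (Fin 3) ℂ} (hp : p.IsHomogeneous 3) :
    ∃ x y : ℂ, (x ≠ 0 ∨ y ≠ 0) ∧ eval ![x, y, 0] p = 0 := by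
  obtain ⟨e, he⟩ := exists_binary_coeff hp
  simp only [Finset.sum_range_succ, Finset.sum_range_zero] at he
  by_cases h3 : e 3 = 0
  · exact ⟨1, 0, by simp, by simp [he, h3]⟩
  · obtain ⟨x, hx⟩ := IsAlgClosed.exists_root
      (Polynomial.C (e 3) * Polynomial.X ^ 3 + Polynomial.C (e 2) * Polynomial.X ^ 2 +
        Polynomial.C (e 1) * Polynomial.X + Polynomial.C (e 0))
      (by rw [Polynomial.degree_cubic h3]; norm_num)
    refine ⟨x, 1, by simp, ?_⟩
    simp [Polynomial.IsRoot] at hx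
    rw [he]
    linear_combination hx

lemma hasDerivAt_eval (h : MvPolynomial (Fin 3) ℂ) (p d : Fin 3 → ℂ) :
    HasDerivAt (fun t : ℂ => eval (p + t • d) h) (∑ i, d i * eval p (pderiv i h)) 0 := by
  induction h using MvPolynomial.induction_on with
  | C a => simpa using hasDerivAt_const (0 : ℂ) a
  | add f g hf hg =>
    simp only [map_add]
    refine (hf.add hg).congr_deriv ?_
    rw [← Finset.sum_add_distrib]
    exact Finset.sum_congr rfl fun i _ => by ring
  | mul_X f j hf =>
    have h1 : HasDerivAt (fun t : ℂ => eval (p + t • d) (X j : MvPolynomial (Fin 3) ℂ)) (d j) 0 := by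
      simpa using ((hasDerivAt_id (0 : ℂ)).mul_const (d j)).const_add (p j)
    simp only [map_mul]
    refine (hf.mul h1).congr_deriv ?_
    fin_cases j <;> simp [pderiv_X, Pi.single_apply, Fin.sum_univ_three] <;> ring

/-- The substitution parametrising the line `z = u x + v y`. -/
noncomputable def lineMatrix (u v : ℂ) : Matrix (Fin 3) (Fin 3) ℂ := !![1, 0, 0; 0, 1, 0; u, v, 0]

lemma lineMatrix_mulVec (u v x y z : ℂ) : lineMatrix u v *ᵥ ![x, y, z] = ![x, y, u * x + v * y] := by
  ext i; fin_cases i <;> simp [lineMatrix, mulVec, dotProduct, Fin.sum_univ_three]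

/-- A binary quadratic form, as a ternary form. -/
noncomputable def binQuad (a b c : ℂ) : MvPolynomial (Fin 3) ℂ :=
  C a * X 0 ^ 2 + C b * (X 0 * X 1) + C c * X 1 ^ 2

lemma eval_binQuad (a b c x y z : ℂ) :
    eval ![x, y, z] (binQuad a b c) = a * x ^ 2 + b * x * y + c * y ^ 2 := by
  simp [binQuad]; ring

lemma isHomogeneous_binQuad (a b c : ℂ) : (binQuad a b c).IsHomogeneous 2 := by
  have hX (i : Fin 3) := isHomogeneous_X ℂ i
  exact (((hX 0).pow 2).C_mul a |>.add (((hX 0).mul (hX 1)).C_mul b)).add (((hX 1).pow 2).C_mul c)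

/-- The contact points of a bitangent are simple points of the restricted polar cubic. -/
lemma IsSmoothForm.eval_pderiv_ne_zero {h : MvPolynomial (Fin 3) ℂ} (hs : IsSmoothForm h)
    {u v a b c : ℂ}
    (hq : ∀ x y, eval ![x, y, u * x + v * y] h = (a * x ^ 2 + b * x * y + c * y ^ 2) ^ 2)
    {x y : ℂ} (hxy : x ≠ 0 ∨ y ≠ 0) (h0 : a * x ^ 2 + b * x * y + c * y ^ 2 = 0) :
    eval ![x, y, u * x + v * y] (pderiv 2 h) ≠ 0 := by
  intro hz
  obtain ⟨i, hi⟩ := hs ![x, y, u * x + v * y]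
    (fun e => by
      have e0 := congrFun e 0
      have e1 := congrFun e 1
      simp at e0 e1
      simp [e0, e1] at hxy) (by rw [hq, h0]; ring)
  have key (r s : ℂ) : r * eval ![x, y, u * x + v * y] (pderiv 0 h) +
      s * eval ![x, y, u * x + v * y] (pderiv 1 h) = 0 := by
    have h1 := hasDerivAt_eval h ![x, y, u * x + v * y] ![r, s, u * r + v * s]
    have h2 : HasDerivAt (fun t : ℂ => eval (![x, y, u * x + v * y] + t • ![r, s, u * r + v * s]) h)
        0 0 := by
      have e (t : ℂ) : ![x, y, u * x + v * y] + t • ![r, s, u * r + v * s] =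
          ![x + t * r, y + t * s, u * (x + t * r) + v * (y + t * s)] := by
        ext i; fin_cases i <;> simp
        ring
      simp only [e, hq]
      have e1 : HasDerivAt (fun t : ℂ => x + t * r) r 0 := by
        simpa using ((hasDerivAt_id (0 : ℂ)).mul_const r).const_add x
      have e2 : HasDerivAt (fun t : ℂ => y + t * s) s 0 := by
        simpa using ((hasDerivAt_id (0 : ℂ)).mul_const s).const_add y
      refine (((((e1.pow 2).const_mul a).add ((e1.const_mul b).mul e2)).add
        ((e2.pow 2).const_mul c)).pow 2).congr_deriv ?_
      simp [h0]
    have h3 := h1.unique h2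
    simpa [Fin.sum_univ_three, hz] using h3
  fin_cases i
  · exact hi (by simpa using key 1 0)
  · exact hi (by simpa using key 0 1)
  · exact hi hz

lemma IsSmoothForm.bitangent_rigid {h : MvPolynomial (Fin 3) ℂ} (hh : h.IsHomogeneous 4)
    (hs : IsSmoothForm h) {u v a b c u' v' a' b' c' : ℂ}
    (hq : ∀ x y, eval ![x, y, u * x + v * y] h = (a * x ^ 2 + b * x * y + c * y ^ 2) ^ 2)
    (hd : ∀ x y, (u' * x + v' * y) * eval ![x, y, u * x + v * y] (pderiv 2 h) =
      2 * (a * x ^ 2 + b * x * y + c * y ^ 2) * (a' * x ^ 2 + b' * x * y + c' * y ^ 2)) :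
    u' = 0 ∧ v' = 0 ∧ a' = 0 ∧ b' = 0 ∧ c' = 0 := by
  set K := linSubst (lineMatrix u v) (pderiv 2 h) with hK
  have hKh : K.IsHomogeneous 3 := isHomogeneous_linSubst _ hh.pderiv
  have hKe (x y z : ℂ) : eval ![x, y, z] K = eval ![x, y, u * x + v * y] (pderiv 2 h) := by
    rw [hK, eval_linSubst, lineMatrix_mulVec]
  have hne {x y : ℂ} (hxy : x ≠ 0 ∨ y ≠ 0) (h0 : a * x ^ 2 + b * x * y + c * y ^ 2 = 0) (z : ℂ) :
      eval ![x, y, z] K ≠ 0 := by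
    rw [hKe]
    exact hs.eval_pderiv_ne_zero hq hxy h0
  obtain ⟨p, r, m, n, hfac⟩ := exists_binary_factor a b c
  obtain ⟨x₀, y₀, hxy₀, hK₀⟩ := exists_binary_cubic_zero hKh
  have hprmn : (p * x₀ + r * y₀) * (m * x₀ + n * y₀) ≠ 0 := by
    rw [← hfac]
    exact fun h0 => hne hxy₀ h0 0 hK₀
  have hpr : p ≠ 0 ∨ r ≠ 0 := by
    by_contra! hc
    simp [hc.1, hc.2] at hprmn
  have hmn : m ≠ 0 ∨ n ≠ 0 := by
    by_contra! hc
    simp [hc.1, hc.2] at hprmn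
  have hL1 : linForm ![p, r, 0] ≠ 0 := linForm_ne_zero fun e => by
    have e0 := congrFun e 0
    have e1 := congrFun e 1
    simp at e0 e1
    simp [e0, e1] at hpr
  have hL2 : linForm ![m, n, 0] ≠ 0 := linForm_ne_zero fun e => by
    have e0 := congrFun e 0
    have e1 := congrFun e 1
    simp at e0 e1
    simp [e0, e1] at hmn
  have hvec (x : Fin 3 → ℂ) : x = ![x 0, x 1, x 2] := by ext i; fin_cases i <;> rfl
  have hw : u' * r - v' * p = 0 := by
    have h1 := hd r (-p)
    have h2 := hne (x := r) (y := -p) (by simpa [or_comm] using hpr)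
      (by rw [hfac]; ring) 0
    rw [hfac, ← hKe _ _ 0] at h1
    exact (mul_eq_zero.mp (show (u' * r - v' * p) * _ = 0 by
      linear_combination h1)).resolve_right h2
  obtain ⟨k, hk1, hk2⟩ : ∃ k, u' = k * p ∧ v' = k * r := by
    rcases hpr with hp | hr
    · exact ⟨u' / p, by field_simp, by field_simp; linear_combination -hw⟩
    · exact ⟨v' / r, by field_simp; linear_combination hw, by field_simp⟩
  have hcancel : C k * K = 2 * linForm ![m, n, 0] * binQuad a' b' c' := by
    refine mul_left_cancel₀ hL1 (MvPolynomial.funext fun x => ?_)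
    rw [hvec x]
    have h1 := hd (x 0) (x 1)
    rw [hfac, ← hKe _ _ (x 2), hk1, hk2] at h1
    simp only [map_mul, eval_linForm, eval_C, eval_binQuad, map_ofNat, cons_dotProduct]
    simp [-mul_eq_mul_left_iff, -mul_eq_mul_right_iff]
    linear_combination h1
  have hk : k = 0 := by
    have h1 := congrArg (eval ![n, -m, 0]) hcancel
    have h2 := hne (x := n) (y := -m) (by simpa [or_comm] using hmn) (by rw [hfac]; ring) 0
    simp only [map_mul, eval_linForm, eval_C, cons_dotProduct] at h1
    refine (mul_eq_zero.mp (h1.trans ?_)).resolve_right h2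
    simp
    left
    ring
  have hQ : binQuad a' b' c' = 0 := by
    rw [hk] at hcancel
    simpa [hL2] using hcancel.symm
  have h1 := congrArg (eval ![1, 0, 0]) hQ
  have h2 := congrArg (eval ![0, 1, 0]) hQ
  have h3 := congrArg (eval ![1, 1, 0]) hQ
  simp only [eval_binQuad, map_zero] at h1 h2 h3
  refine ⟨by simp [hk1, hk], by simp [hk2, hk], by linear_combination h1,
    by linear_combination h3 - h1 - h2, by linear_combination h2⟩

lemma IsBitangent.smul {h : MvPolynomial (Fin 3) ℂ} {l : Fin 3 → ℂ} (hl : IsBitangent h l) {k : ℂ}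
    (hk : k ≠ 0) : IsBitangent h (k • l) := by
  obtain ⟨b, hb, H⟩ := hl
  exact ⟨b, hb, fun x hx => H x (by simpa [hk] using hx)⟩

lemma binQuad_inj {a b c a' b' c' : ℂ} (h : binQuad a b c = binQuad a' b' c') :
    a = a' ∧ b = b' ∧ c = c' := by
  have h1 := congrArg (eval ![1, 0, 0]) h
  have h2 := congrArg (eval ![0, 1, 0]) h
  have h3 := congrArg (eval ![1, 1, 0]) h
  simp only [eval_binQuad] at h1 h2 h3
  exact ⟨by linear_combination h1, by linear_combination h3 - h1 - h2, by linear_combination h2⟩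

/-- The line `z = x 0 * X + x 1 * Y` meets the curve `h` in twice the divisor of
`x 2 * X ^ 2 + x 3 * X * Y + x 4 * Y ^ 2`. -/
def IsContact (h : MvPolynomial (Fin 3) ℂ) (x : Fin 5 → ℂ) : Prop :=
  ∀ X Y, eval ![X, Y, x 0 * X + x 1 * Y] h = (x 2 * X ^ 2 + x 3 * X * Y + x 4 * Y ^ 2) ^ 2

lemma isBitangent_iff_exists_isContact {h : MvPolynomial (Fin 3) ℂ} {u v : ℂ} :
    IsBitangent h ![u, v, -1] ↔ ∃ x, IsContact h x ∧ x 0 = u ∧ x 1 = v := by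
  constructor
  · rintro ⟨b, hb, H⟩
    obtain ⟨e, he⟩ := exists_binary_coeff (isHomogeneous_linSubst (lineMatrix u v) hb)
    refine ⟨![u, v, e 2, e 1, e 0], fun X Y => ?_, rfl, rfl⟩
    have h1 := he X Y
    rw [eval_linSubst, lineMatrix_mulVec] at h1
    change eval ![X, Y, u * X + v * Y] h = (e 2 * X ^ 2 + e 1 * X * Y + e 0 * Y ^ 2) ^ 2
    rw [H _ (by simp [dotProduct, Fin.sum_univ_three]), h1]
    simp [Finset.sum_range_succ]
    ring
  · rintro ⟨x, hx, rfl, rfl⟩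
    refine ⟨binQuad (x 2) (x 3) (x 4), isHomogeneous_binQuad _ _ _, fun y hy => ?_⟩
    have h2 : y = ![y 0, y 1, x 0 * y 0 + x 1 * y 1] := by
      simp [dotProduct, Fin.sum_univ_three] at hy
      ext i; fin_cases i
      · rfl
      · rfl
      · change y 2 = x 0 * y 0 + x 1 * y 1
        linear_combination -hy
    rw [h2, eval_binQuad, hx]

section
variable {h : MvPolynomial (Fin 3) ℂ}

lemma IsContact.eq_or_eq_neg {x y : Fin 5 → ℂ} (hx : IsContact h x) (hy : IsContact h y)
    (h0 : x 0 = y 0) (h1 : x 1 = y 1) : y = x ∨ y = ![x 0, x 1, -x 2, -x 3, -x 4] := by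
  have hvec (x : Fin 3 → ℂ) : x = ![x 0, x 1, x 2] := by ext i; fin_cases i <;> rfl
  have key : binQuad (y 2) (y 3) (y 4) ^ 2 = binQuad (x 2) (x 3) (x 4) ^ 2 := by
    refine MvPolynomial.funext fun z => ?_
    rw [hvec z]
    simp only [map_pow, eval_binQuad]
    rw [← hx, ← hy, h0, h1]
  rcases sq_eq_sq_iff_eq_or_eq_neg.mp key with e | e
  · left
    obtain ⟨e2, e3, e4⟩ := binQuad_inj e
    ext i; fin_cases i
    exacts [h0.symm, h1.symm, e2, e3, e4]
  · right
    have : -binQuad (x 2) (x 3) (x 4) = binQuad (-x 2) (-x 3) (-x 4) := by simp [binQuad]; ring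
    rw [this] at e
    obtain ⟨e2, e3, e4⟩ := binQuad_inj e
    ext i; fin_cases i
    exacts [h0.symm, h1.symm, e2, e3, e4]

lemma IsContact.neg {x : Fin 5 → ℂ} (hx : IsContact h x) :
    IsContact h ![x 0, x 1, -x 2, -x 3, -x 4] := fun X Y => by
  change eval ![X, Y, x 0 * X + x 1 * Y] h = (-x 2 * X ^ 2 + -x 3 * X * Y + -x 4 * Y ^ 2) ^ 2
  rw [hx]
  ring

lemma IsContact.ne_neg (hh : h.IsHomogeneous 4) (hs : IsSmoothForm h) {x : Fin 5 → ℂ}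
    (hx : IsContact h x) : x ≠ ![x 0, x 1, -x 2, -x 3, -x 4] := by
  intro e
  have e2 : x 2 = -x 2 := congrFun e 2
  have e3 : x 3 = -x 3 := congrFun e 3
  have e4 : x 4 = -x 4 := congrFun e 4
  rw [self_eq_neg] at e2 e3 e4
  have := hs.bitangent_rigid hh (u' := 0) (v' := 0) (a' := 1) (b' := 0) (c' := 0) hx
    fun X Y => by simp [e2, e3, e4]
  exact one_ne_zero this.2.2.1

lemma exists_isBitangentSystem (hh : h.IsHomogeneous 4) (hs : IsSmoothForm h)
    (hfin : {x | IsContact h x}.Finite) (hz : ∀ l, l ≠ 0 → IsBitangent h l → l 2 ≠ 0) :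
    ∃ T, IsBitangentSystem h T ∧ 2 * T.card = {x | IsContact h x}.ncard := by
  classical
  let π : (Fin 5 → ℂ) → Fin 3 → ℂ := fun x => ![x 0, x 1, -1]
  refine ⟨hfin.toFinset.image π, ⟨?_, ?_, ?_, ?_⟩, ?_⟩
  · intro l hl h0
    obtain ⟨x, -, rfl⟩ := Finset.mem_image.mp hl
    have := congrFun h0 2
    simp [π] at this
  · intro l hl
    obtain ⟨x, hx, rfl⟩ := Finset.mem_image.mp hl
    exact isBitangent_iff_exists_isContact.mpr ⟨x, by simpa using hx, rfl, rfl⟩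
  · intro l hl m hm hlm hc
    obtain ⟨x, hx, rfl⟩ := Finset.mem_image.mp hl
    obtain ⟨y, hy, rfl⟩ := Finset.mem_image.mp hm
    obtain ⟨k, hk⟩ := (cross_eq_zero_iff (fun h0 => by
      have := congrFun h0 2
      simp [π] at this)).mp hc
    have h2 := congrFun hk 2
    simp [π] at h2
    exact hlm (by rw [hk, ← h2, one_smul])
  · intro l hl hb
    have h2 := hz l hl hb
    have e : (-(l 2)⁻¹) • l = ![-(l 2)⁻¹ * l 0, -(l 2)⁻¹ * l 1, -1] := by
      ext i; fin_cases i <;> simp [h2]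
    have hb' := hb.smul (k := -(l 2)⁻¹) (by simpa using h2)
    refine ⟨_, ?_, (cross_eq_zero_iff hl).mpr ⟨-(l 2)⁻¹, rfl⟩⟩
    rw [e] at hb' ⊢
    obtain ⟨x, hx, h0, h1⟩ := isBitangent_iff_exists_isContact.mp hb'
    exact Finset.mem_image.mpr ⟨x, by simpa using hx, by simp [π, h0, h1]⟩
  · rw [Set.ncard_eq_toFinset_card _ hfin,
      Finset.card_eq_sum_card_image π hfin.toFinset, mul_comm, ← smul_eq_mul, ← Finset.sum_const]
    refine Finset.sum_congr rfl fun l hl => ?_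
    obtain ⟨x, hx, rfl⟩ := Finset.mem_image.mp hl
    have hx' : IsContact h x := by simpa using hx
    symm
    rw [Finset.card_eq_two]
    refine ⟨x, _, hx'.ne_neg hh hs, ?_⟩
    ext y
    simp only [Finset.mem_filter, Set.Finite.mem_toFinset, Set.mem_ofPred_eq, Finset.mem_insert,
      Finset.mem_singleton]
    constructor
    · rintro ⟨hy, hyx⟩
      exact hx'.eq_or_eq_neg hy (congrFun hyx 0).symm (congrFun hyx 1).symm
    · rintro (rfl | rfl)
      · exact ⟨hx', rfl⟩
      · exact ⟨hx'.neg, rfl⟩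

end

/-- The equations for `IsContact (F + C s * G) x`, sampled at five points. -/
noncomputable def contactMap (F G : MvPolynomial (Fin 3) ℂ) (p : ℂ × (Fin 5 → ℂ)) (k : Fin 5) : ℂ :=
  eval ![1, (k : ℂ), p.2 0 + p.2 1 * k] F + p.1 * eval ![1, (k : ℂ), p.2 0 + p.2 1 * k] G -
    (p.2 2 + p.2 3 * k + p.2 4 * k ^ 2) ^ 2

section
variable {F G : MvPolynomial (Fin 3) ℂ} (hF : F.IsHomogeneous 4) (hG : G.IsHomogeneous 4)
include hF hG

lemma contactMap_eq_zero_iff {s : ℂ} {x : Fin 5 → ℂ} :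
    contactMap F G (s, x) = 0 ↔ IsContact (F + C s * G) x := by
  constructor
  · intro h X Y
    have hhom : (linSubst (lineMatrix (x 0) (x 1)) (F + C s * G) -
        binQuad (x 2) (x 3) (x 4) ^ 2).IsHomogeneous 4 :=
      (isHomogeneous_linSubst _ (hF.add (hG.C_mul s))).sub ((isHomogeneous_binQuad _ _ _).pow 2)
    have := eval_binary_eq_zero hhom (fun k => by
      have hk := congrFun h k
      simp only [contactMap, Pi.zero_apply] at hk
      simp only [map_sub, map_pow, eval_linSubst, lineMatrix_mulVec, eval_binQuad, map_add,
        map_mul, eval_C, mul_one]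
      linear_combination hk) X Y
    simp only [map_sub, map_pow, eval_linSubst, lineMatrix_mulVec, eval_binQuad] at this
    linear_combination this
  · intro h
    ext k
    have := h 1 k
    simp only [map_add, map_mul, eval_C, mul_one] at this
    simp only [contactMap, Pi.zero_apply]
    linear_combination this

omit hF hG in
lemma analyticAt_contactMap (p : ℂ × (Fin 5 → ℂ)) : AnalyticAt ℂ (contactMap F G) p := by
  have h1 : AnalyticAt ℂ (fun p : ℂ × (Fin 5 → ℂ) => p.1) p := analyticAt_fst
  have h2 (i : Fin 5) : AnalyticAt ℂ (fun p : ℂ × (Fin 5 → ℂ) => p.2 i) p :=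
    ((ContinuousLinearMap.proj (R := ℂ) (φ := fun _ : Fin 5 => ℂ) i).comp
      (ContinuousLinearMap.snd ℂ ℂ (Fin 5 → ℂ))).analyticAt p
  have hev (H : MvPolynomial (Fin 3) ℂ) (k : Fin 5) : AnalyticAt ℂ
      (fun p : ℂ × (Fin 5 → ℂ) => eval ![1, (k : ℂ), p.2 0 + p.2 1 * k] H) p := by
    refine AnalyticAt.aeval_mvPolynomial (fun i => ?_) H
    fin_cases i
    · exact analyticAt_const
    · exact analyticAt_const
    · exact (h2 0).add ((h2 1).mul analyticAt_const)
  rw [analyticAt_pi_iff]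
  intro k
  exact ((hev F k).add (h1.mul (hev G k))).sub
    ((((h2 2).add ((h2 3).mul analyticAt_const)).add ((h2 4).mul analyticAt_const)).pow 2)

lemma contactMap_injective {s : ℂ} (hs : IsSmoothForm (F + C s * G)) {x : Fin 5 → ℂ}
    (hx : contactMap F G (s, x) = 0) (v : Fin 5 → ℂ)
    (hv : fderiv ℂ (contactMap F G) (s, x) (0, v) = 0) : v = 0 := by
  have hh := hF.add (hG.C_mul s)
  have hc := (contactMap_eq_zero_iff hF hG).mp hx
  have hline : HasDerivAt (fun t : ℂ => ((s, x + t • v) : ℂ × (Fin 5 → ℂ))) (0, v) 0 := by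
    refine (hasDerivAt_const _ _).prodMk ?_
    simpa using ((hasDerivAt_id (0 : ℂ)).smul_const v).const_add x
  have hfd : HasFDerivAt (contactMap F G) (fderiv ℂ (contactMap F G) (s, x)) (s, x + (0 : ℂ) • v) := by
    rw [zero_smul, add_zero]
    exact (analyticAt_contactMap _).differentiableAt.hasFDerivAt
  have h1 := hfd.comp_hasDerivAt (0 : ℂ) hline
  rw [hv, hasDerivAt_pi] at h1
  have hk (k : Fin 5) : (v 0 + v 1 * k) * eval ![1, (k : ℂ), x 0 + x 1 * k] (pderiv 2 (F + C s * G)) =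
      2 * (x 2 + x 3 * k + x 4 * k ^ 2) * (v 2 + v 3 * k + v 4 * k ^ 2) := by
    have e1 := hasDerivAt_eval (F + C s * G) ![1, (k : ℂ), x 0 + x 1 * k] ![0, 0, v 0 + v 1 * k]
    have hco (i : Fin 5) : HasDerivAt (fun t : ℂ => x i + t * v i) (v i) 0 := by
      simpa using ((hasDerivAt_id (0 : ℂ)).mul_const (v i)).const_add (x i)
    have e2 := (((hco 2).add ((hco 3).mul_const (k : ℂ))).add ((hco 4).mul_const ((k : ℂ) ^ 2))).pow 2
    have e3 := (e1.sub e2).unique ((h1 k).congr_of_eventuallyEq (Filter.Eventually.of_forall fun t => ?_))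
    · simp [Fin.sum_univ_three] at e3 ⊢
      linear_combination e3
    · have e : ![1, (k : ℂ), x 0 + x 1 * k] + t • ![0, 0, v 0 + v 1 * k] =
          ![1, (k : ℂ), (x 0 + t * v 0) + (x 1 + t * v 1) * k] := by
        ext i; fin_cases i <;> simp
        ring
      rw [Pi.sub_apply, e]
      simp [contactMap]
  have hhom : (linForm ![v 0, v 1, 0] * linSubst (lineMatrix (x 0) (x 1)) (pderiv 2 (F + C s * G)) -
      C 2 * (binQuad (x 2) (x 3) (x 4) * binQuad (v 2) (v 3) (v 4))).IsHomogeneous 4 :=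
    ((isHomogeneous_linForm _).mul (isHomogeneous_linSubst _ hh.pderiv)).sub
      (((isHomogeneous_binQuad _ _ _).mul (isHomogeneous_binQuad _ _ _)).C_mul 2)
  have h3 := eval_binary_eq_zero hhom fun k => by
    have := hk k
    simp only [map_sub, map_mul, eval_linForm, eval_linSubst, lineMatrix_mulVec, eval_binQuad,
      eval_C, mul_one, dotProduct, Fin.sum_univ_three]
    simp only [Matrix.cons_val]
    linear_combination this
  obtain ⟨v0, v1, v2, v3, v4⟩ := hs.bitangent_rigid hh (u' := v 0) (v' := v 1) (a' := v 2)
    (b' := v 3) (c' := v 4) hc fun X Y => by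
      have := h3 X Y
      simp only [map_sub, map_mul, eval_linForm, eval_linSubst, lineMatrix_mulVec, eval_binQuad,
        eval_C, dotProduct, Fin.sum_univ_three] at this
      simp only [Matrix.cons_val] at this
      linear_combination this
  ext i; fin_cases i
  exacts [v0, v1, v2, v3, v4]

end

/-- The cross product expresses the condition of being bitangent without division. -/
lemma isBitangent_iff_cross {h : MvPolynomial (Fin 3) ℂ} {l : Fin 3 → ℂ} (hl : l ≠ 0) :
    IsBitangent h l ↔ ∃ M : Matrix (Fin 3) (Fin 3) ℂ, M.IsSymm ∧
      ∀ v, eval (crossProduct l v) h = (v ⬝ᵥ M *ᵥ v) ^ 2 := by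
  have hmat (l v : Fin 3 → ℂ) : LinearMap.toMatrix' (crossProduct l) *ᵥ v = crossProduct l v :=
    LinearMap.toMatrix'_mulVec _ _
  constructor
  · rintro ⟨b, hb, H⟩
    have hb' := isHomogeneous_linSubst (LinearMap.toMatrix' (crossProduct l)) hb
    refine ⟨(1 / 2 : ℂ) • quadHess (linSubst (LinearMap.toMatrix' (crossProduct l)) b), ?_,
      fun v => ?_⟩
    · rw [Matrix.IsSymm, transpose_smul, (quadHess_isSymm _).eq]
    · rw [H _ (dot_self_cross _ _), smul_mulVec, dotProduct_smul,
        ← two_mul_eval_of_isHomogeneous_two hb', eval_linSubst, hmat]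
      simp
  · rintro ⟨M, -, H⟩
    obtain ⟨w, hw⟩ := exists_dotProduct_eq_one hl
    have hq : (∑ i, X i * linForm (M i)).IsHomogeneous 2 :=
      IsHomogeneous.sum _ _ _ fun i _ => (isHomogeneous_X ℂ i).mul (isHomogeneous_linForm _)
    refine ⟨linSubst (-LinearMap.toMatrix' (crossProduct w)) _, isHomogeneous_linSubst _ hq,
      fun x hx => ?_⟩
    have hx' : crossProduct l (crossProduct x w) = x := by
      rw [← cross_anticomm, cross_cross_eq_smul_sub_smul, dotProduct_comm w l, hw,
        dotProduct_comm x l, hx]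
      simp
    have h1 := H (crossProduct x w)
    rw [hx'] at h1
    rw [h1, eval_linSubst, neg_mulVec, hmat, cross_anticomm]
    simp only [map_sum, map_mul, eval_X, eval_linForm]
    rfl

lemma exists_sqrt_bound {X : Type*} [TopologicalSpace X] {K : Set X} (hK : IsCompact K) {g : X → ℂ}
    (hg : Continuous g) : ∃ R : ℝ, 1 ≤ R ∧ ∀ x ∈ K, ∀ q : ℂ, q ^ 2 = g x → ‖q‖ ≤ R := by
  obtain ⟨B, hB⟩ := hK.exists_bound_of_continuousOn hg.continuousOn
  refine ⟨max 1 B, le_max_left _ _, fun x hx q hq => ?_⟩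
  by_contra! hlt
  have h1 := hB x hx
  rw [← hq, norm_pow] at h1
  have h2 := le_max_left 1 B
  have h3 := le_max_right 1 B
  nlinarith

lemma Continuous.crossProduct {X : Type*} [TopologicalSpace X] {a b : X → Fin 3 → ℂ}
    (ha : Continuous a) (hb : Continuous b) : Continuous fun x => crossProduct (a x) (b x) := by
  simp only [cross_apply]
  refine continuous_pi fun i => ?_
  fin_cases i <;> simp <;> fun_prop

section
open Filter Topology

variable {F G : MvPolynomial (Fin 3) ℂ} {s₀ : ℂ}

lemma Continuous.eval_pencil {X : Type*} [TopologicalSpace X] {a : X → ℂ} {b : X → Fin 3 → ℂ}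
    (ha : Continuous a) (hb : Continuous b) : Continuous fun x => eval (b x) (F + C (a x) * G) := by
  have (H : MvPolynomial (Fin 3) ℂ) : Continuous fun x => eval (b x) H := (continuous_eval H).comp hb
  simp only [map_add, map_mul, eval_C]
  exact (this F).add (ha.mul (this G))

lemma exists_matrix_bound : ∃ R : ℝ, ∀ s ∈ Metric.closedBall s₀ 1, ∀ l ∈ Metric.sphere (0 : Fin 3 → ℂ) 1,
    ∀ M : Matrix (Fin 3) (Fin 3) ℂ, M.IsSymm →
      (∀ v, eval (crossProduct l v) (F + C s * G) = (v ⬝ᵥ M *ᵥ v) ^ 2) → ∀ i j, ‖M i j‖ ≤ R := by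
  obtain ⟨R, hR1, hR⟩ := exists_sqrt_bound (K := Metric.closedBall s₀ 1 ×ˢ
    Metric.sphere (0 : Fin 3 → ℂ) 1 ×ˢ Metric.closedBall (0 : Fin 3 → ℂ) 2)
    ((isCompact_closedBall _ _).prod ((isCompact_sphere _ _).prod (isCompact_closedBall _ _)))
    (g := fun p => eval (crossProduct p.2.1 p.2.2) (F + C p.1 * G))
    (continuous_fst.eval_pencil (.crossProduct (by fun_prop) (by fun_prop)))
  refine ⟨2 * R, fun s hs l hl M hM H i j => ?_⟩
  have hb (v : Fin 3 → ℂ) (hv : ‖v‖ ≤ 2) : ‖v ⬝ᵥ M *ᵥ v‖ ≤ R :=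
    hR (s, l, v) ⟨hs, hl, by simpa using hv⟩ _ (H v).symm
  have h1 (i : Fin 3) : ‖(Pi.single i 1 : Fin 3 → ℂ)‖ ≤ 1 := by
    rw [pi_norm_le_iff_of_nonneg zero_le_one]
    intro j
    rw [Pi.single_apply]
    split_ifs <;> simp
  have hi := hb (Pi.single i 1) ((h1 i).trans one_le_two)
  have hj := hb (Pi.single j 1) ((h1 j).trans one_le_two)
  have hij := hb (Pi.single i 1 + Pi.single j 1)
    ((norm_add_le _ _).trans (by linarith [h1 i, h1 j]))
  have e : 2 * M i j = ((Pi.single i 1 + Pi.single j 1 : Fin 3 → ℂ) ⬝ᵥ M *ᵥ (Pi.single i 1 + Pi.single j 1))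
      - Pi.single i 1 ⬝ᵥ M *ᵥ Pi.single i 1 - Pi.single j 1 ⬝ᵥ M *ᵥ Pi.single j 1 := by
    simp [mulVec_add, add_dotProduct, dotProduct_add, hM.apply i j]
    ring
  have h2 := congrArg norm e
  rw [norm_mul, Complex.norm_ofNat] at h2
  have h3 := norm_sub_le ((Pi.single i 1 + Pi.single j 1 : Fin 3 → ℂ) ⬝ᵥ M *ᵥ (Pi.single i 1 + Pi.single j 1)
      - Pi.single i 1 ⬝ᵥ M *ᵥ Pi.single i 1) (Pi.single j 1 ⬝ᵥ M *ᵥ Pi.single j 1)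
  have h4 := norm_sub_le ((Pi.single i 1 + Pi.single j 1 : Fin 3 → ℂ) ⬝ᵥ M *ᵥ (Pi.single i 1 + Pi.single j 1))
      (Pi.single i 1 ⬝ᵥ M *ᵥ Pi.single i 1)
  linarith

lemma exists_lower_bound (hz : ∀ l, l ≠ 0 → IsBitangent (F + C s₀ * G) l → l 2 ≠ 0) :
    ∃ ε : ℝ, 0 < ε ∧ ∀ s ∈ Metric.closedBall s₀ 1, ∀ l ∈ Metric.sphere (0 : Fin 3 → ℂ) 1,
      IsBitangent (F + C s * G) l → ε ≤ ‖s - s₀‖ + ‖l 2‖ := by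
  obtain ⟨R, hR⟩ := exists_matrix_bound (F := F) (G := G) (s₀ := s₀)
  let P : Set (ℂ × (Fin 3 → ℂ) × (Fin 3 → Fin 3 → ℂ)) :=
    Metric.closedBall s₀ 1 ×ˢ Metric.sphere (0 : Fin 3 → ℂ) 1 ×ˢ
      Metric.closedBall (0 : Fin 3 → Fin 3 → ℂ) R
  let Z : Set (ℂ × (Fin 3 → ℂ) × (Fin 3 → Fin 3 → ℂ)) :=
    {p | ∀ v, eval (crossProduct p.2.1 v) (F + C p.1 * G) = (∑ i, v i * ∑ j, p.2.2 i j * v j) ^ 2}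
  have hP : IsCompact P :=
    (isCompact_closedBall _ _).prod ((isCompact_sphere _ _).prod (isCompact_closedBall _ _))
  have hZ : IsClosed Z := by
    simp only [Z, Set.ofPred_forall]
    refine isClosed_iInter fun v => isClosed_eq ?_ (by fun_prop)
    exact continuous_fst.eval_pencil (.crossProduct (by fun_prop) continuous_const)
  have hne {l : Fin 3 → ℂ} (hl : l ∈ Metric.sphere (0 : Fin 3 → ℂ) 1) : l ≠ 0 := by
    rintro rfl
    simp at hl
  obtain ⟨ε, hε, H⟩ := (hP.inter_right hZ).exists_forall_le' (a := 0)
    (f := fun p => ‖p.1 - s₀‖ + ‖p.2.1 2‖) (by fun_prop) (by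
      rintro ⟨s, l, M⟩ ⟨⟨-, hl, -⟩, hM⟩
      by_cases hs : s = s₀
      · subst hs
        have h1 : IsBitangent (F + C s * G) l := by
          have hM' : ∀ v : Fin 3 → ℂ, eval (crossProduct l v) (F + C s * G) =
            (v ⬝ᵥ Matrix.of M *ᵥ v) ^ 2 := hM
          obtain ⟨w, hw⟩ := exists_dotProduct_eq_one (hne hl)
          refine (isBitangent_iff_cross (hne hl)).mpr
            ⟨(1 / 2 : ℂ) • (Matrix.of M + (Matrix.of M)ᵀ), ?_, fun v => ?_⟩
          · rw [Matrix.IsSymm, transpose_smul, transpose_add, transpose_transpose, add_comm]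
          · rw [hM', smul_mulVec, add_mulVec, dotProduct_smul, dotProduct_add, mulVec_transpose,
              dotProduct_comm v (v ᵥ* _), ← dotProduct_mulVec, smul_eq_mul]
            ring
        have := norm_pos_iff.mpr (hz l (hne hl) h1)
        positivity
      · have := norm_pos_iff.mpr (sub_ne_zero.mpr hs)
        positivity)
  refine ⟨ε, hε, fun s hs l hl hb => ?_⟩
  obtain ⟨M, hM, hMv⟩ := (isBitangent_iff_cross (hne hl)).mp hb
  have hM0 : 0 ≤ R := (norm_nonneg _).trans (hR s hs l hl M hM hMv 0 0)
  refine H (s, l, M) ⟨⟨hs, hl, ?_⟩, hMv⟩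
  rw [mem_closedBall_zero_iff, pi_norm_le_iff_of_nonneg hM0]
  intro i
  rw [pi_norm_le_iff_of_nonneg hM0]
  exact hR s hs l hl M hM hMv i

lemma eventually_isContact_mem_compact (hz : ∀ l, l ≠ 0 → IsBitangent (F + C s₀ * G) l → l 2 ≠ 0) :
    ∃ K : Set (Fin 5 → ℂ), IsCompact K ∧ ∀ᶠ s in 𝓝 s₀,
      (∀ l, l ≠ 0 → IsBitangent (F + C s * G) l → l 2 ≠ 0) ∧
      ∀ x, IsContact (F + C s * G) x → x ∈ K := by
  obtain ⟨ε, hε, H⟩ := exists_lower_bound hz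
  let D : ℝ := 2 / ε
  let P := Metric.closedBall s₀ 1 ×ˢ Metric.closedBall (0 : ℂ) D ×ˢ Metric.closedBall (0 : ℂ) D
  have hP : IsCompact P :=
    (isCompact_closedBall _ _).prod ((isCompact_closedBall _ _).prod (isCompact_closedBall _ _))
  have hcont (X Y : ℂ) : Continuous fun p : ℂ × ℂ × ℂ =>
      eval ![X, Y, p.2.1 * X + p.2.2 * Y] (F + C p.1 * G) := by
    refine continuous_fst.eval_pencil (continuous_pi fun i => ?_)
    fin_cases i <;> simp <;> fun_prop
  obtain ⟨R₁, hR₁, H₁⟩ := exists_sqrt_bound hP (hcont 1 0)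
  obtain ⟨R₂, hR₂, H₂⟩ := exists_sqrt_bound hP (hcont 0 1)
  obtain ⟨R₃, hR₃, H₃⟩ := exists_sqrt_bound hP (hcont 1 1)
  have hscale {s : ℂ} (hs : dist s s₀ < min 1 (ε / 2)) {l : Fin 3 → ℂ} (hl : l ≠ 0)
      (hb : IsBitangent (F + C s * G) l) : ε / 2 * ‖l‖ ≤ ‖l 2‖ := by
    have hpos := norm_pos_iff.mpr hl
    have hk : ((‖l‖⁻¹ : ℝ) : ℂ) ≠ 0 := by
      rw [Complex.ofReal_ne_zero]
      positivity
    have h1 := H s (by rw [Metric.mem_closedBall]; linarith [hs.trans_le (min_le_left _ _)])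
      (((‖l‖⁻¹ : ℝ) : ℂ) • l) (by
        rw [mem_sphere_zero_iff_norm, norm_smul, Complex.norm_real, norm_inv, norm_norm]
        exact inv_mul_cancel₀ hpos.ne') (hb.smul hk)
    have h2 := hs.trans_le (min_le_right _ _)
    rw [dist_eq_norm] at h2
    rw [Pi.smul_apply, norm_smul, Complex.norm_real, norm_inv, norm_norm] at h1
    have h3 : ε / 2 ≤ ‖l‖⁻¹ * ‖l 2‖ := by linarith
    calc ε / 2 * ‖l‖ ≤ ‖l‖⁻¹ * ‖l 2‖ * ‖l‖ := by gcongr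
      _ = ‖l 2‖ := by field_simp
  refine ⟨Metric.closedBall 0 (D + R₁ + R₂ + R₃), isCompact_closedBall _ _, ?_⟩
  filter_upwards [Metric.ball_mem_nhds s₀ (show 0 < min 1 (ε / 2) by positivity)] with s hs
  refine ⟨fun l hl hb h0 => ?_, fun x hx => ?_⟩
  · have h1 := hscale hs hl hb
    rw [h0, norm_zero] at h1
    have := norm_pos_iff.mpr hl
    have : 0 < ε / 2 * ‖l‖ := by positivity
    linarith
  · have hl : ![x 0, x 1, -1] ≠ 0 := fun h0 => by simpa using congrFun h0 2
    have h1 := hscale hs hl (isBitangent_iff_exists_isContact.mpr ⟨x, hx, rfl, rfl⟩)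
    have h2 : ‖![x 0, x 1, -1]‖ ≤ D := by
      simp only [cons_val, norm_neg, norm_one] at h1
      rw [le_div_iff₀ hε]
      linarith
    have hD : 0 ≤ D := by positivity
    have hx0 : ‖x 0‖ ≤ D := (norm_le_pi_norm ![x 0, x 1, -1] 0).trans h2
    have hx1 : ‖x 1‖ ≤ D := (norm_le_pi_norm ![x 0, x 1, -1] 1).trans h2
    have hmem : (s, x 0, x 1) ∈ P := by
      refine ⟨?_, by simpa using hx0, by simpa using hx1⟩
      rw [Metric.mem_closedBall]
      linarith [(Metric.mem_ball.mp hs).trans_le (min_le_left _ _)]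
    have h3 := H₁ _ hmem (x 2) (by rw [hx]; ring)
    have h4 := H₂ _ hmem (x 4) (by rw [hx]; ring)
    have h5 := H₃ _ hmem (x 2 + x 3 + x 4) (by rw [hx]; ring)
    have h6 : ‖x 3‖ ≤ R₁ + R₂ + R₃ := by
      have : x 3 = (x 2 + x 3 + x 4) - x 2 - x 4 := by ring
      have h7 := norm_sub_le (x 2 + x 3 + x 4 - x 2) (x 4)
      have h8 := norm_sub_le (x 2 + x 3 + x 4) (x 2)
      rw [this]
      linarith
    rw [mem_closedBall_zero_iff, pi_norm_le_iff_of_nonneg (by linarith)]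
    intro i
    fin_cases i <;> simp <;> linarith

end

lemma linSubst_linSubst (A B : Matrix (Fin 3) (Fin 3) ℂ) (h : MvPolynomial (Fin 3) ℂ) :
    linSubst A (linSubst B h) = linSubst (B * A) h :=
  MvPolynomial.funext fun x => by simp

lemma linSubst_one (h : MvPolynomial (Fin 3) ℂ) : linSubst 1 h = h :=
  MvPolynomial.funext fun x => by simp

section
variable {h : MvPolynomial (Fin 3) ℂ} {A B : Matrix (Fin 3) (Fin 3) ℂ}

lemma IsSmoothForm.linSubst (hs : IsSmoothForm h) (hAB : A * B = 1) :
    IsSmoothForm (linSubst A h) := by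
  have hBA : B * A = 1 := mul_eq_one_comm.mp hAB
  intro x hx h0
  rw [eval_linSubst] at h0
  obtain ⟨i, hi⟩ := hs (A *ᵥ x) (fun e => hx (by
    have := congrArg (B *ᵥ ·) e
    simpa [hBA] using this)) h0
  by_contra! hc
  have h1 := hasDerivAt_eval (_root_.linSubst A h) x (B *ᵥ Pi.single i 1)
  simp only [hc, mul_zero, Finset.sum_const_zero, eval_linSubst, mulVec_add, mulVec_smul,
    mulVec_mulVec, hAB, one_mulVec] at h1
  have h2 := (hasDerivAt_eval h (A *ᵥ x) (Pi.single i 1)).unique h1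
  simp [Pi.single_apply] at h2
  exact hi h2

lemma IsBitangent.linSubst {l : Fin 3 → ℂ} (hl : IsBitangent h l)
    (A : Matrix (Fin 3) (Fin 3) ℂ) : IsBitangent (linSubst A h) (l ᵥ* A) := by
  obtain ⟨b, hb, H⟩ := hl
  refine ⟨_root_.linSubst A b, isHomogeneous_linSubst _ hb, fun x hx => ?_⟩
  rw [← dotProduct_mulVec] at hx
  rw [eval_linSubst, eval_linSubst, H _ hx]

lemma IsBitangent.of_linSubst {l : Fin 3 → ℂ} (hl : IsBitangent (_root_.linSubst A h) l)
    (hAB : A * B = 1) : IsBitangent h (l ᵥ* B) := by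
  have := hl.linSubst B
  rwa [linSubst_linSubst, hAB, linSubst_one] at this

lemma vecMul_ne_zero_of_mul_eq_one {l : Fin 3 → ℂ} (hl : l ≠ 0) (hAB : A * B = 1) : l ᵥ* A ≠ 0 :=
  fun e => hl (by
    have := congrArg (· ᵥ* B) e
    simpa [hAB] using this)

lemma IsBitangentSystem.linSubst {T : Finset (Fin 3 → ℂ)} (hT : IsBitangentSystem h T)
    (hAB : A * B = 1) :
    ∃ T', IsBitangentSystem (_root_.linSubst A h) T' ∧ T'.card = T.card := by
  classical
  have hBA : B * A = 1 := mul_eq_one_comm.mp hAB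
  have hinj : Function.Injective fun l : Fin 3 → ℂ => l ᵥ* A := fun l m e => by
    have := congrArg (· ᵥ* B) e
    simpa [hAB] using this
  refine ⟨T.image (· ᵥ* A), ⟨?_, ?_, ?_, ?_⟩, Finset.card_image_of_injective _ hinj⟩
  · simp only [Finset.mem_image]
    rintro _ ⟨l, hl, rfl⟩
    exact vecMul_ne_zero_of_mul_eq_one (hT.ne_zero l hl) hAB
  · simp only [Finset.mem_image]
    rintro _ ⟨l, hl, rfl⟩
    exact (hT.isBitangent l hl).linSubst A
  · simp only [Finset.mem_image]
    rintro _ ⟨l, hl, rfl⟩ _ ⟨m, hm, rfl⟩ hlm hc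
    obtain ⟨k, hk⟩ :=
      (cross_eq_zero_iff (vecMul_ne_zero_of_mul_eq_one (hT.ne_zero l hl) hAB)).mp hc
    refine hT.cross_ne_zero l hl m hm (fun e => hlm (by rw [e])) ?_
    exact (cross_eq_zero_iff (hT.ne_zero l hl)).mpr ⟨k, hinj (by simpa [smul_vecMul] using hk)⟩
  · intro l hl hb
    have hl' := vecMul_ne_zero_of_mul_eq_one hl hBA
    obtain ⟨m, hm, hc⟩ := hT.exists_cross_eq_zero _ hl' (hb.of_linSubst hAB)
    obtain ⟨k, hk⟩ := (cross_eq_zero_iff hl').mp hc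
    refine ⟨m ᵥ* A, Finset.mem_image_of_mem _ hm, (cross_eq_zero_iff hl).mpr ⟨k, ?_⟩⟩
    rw [hk, smul_vecMul, vecMul_vecMul, hBA, vecMul_one]

lemma countable_bitangents_chart (hh : h.IsHomogeneous 4) (hs : IsSmoothForm h) :
    {l | IsBitangent h l ∧ l 2 = -1}.Countable := by
  have h0 : h + C 0 * 0 = h := by simp
  have hZ := countable_zeros (s₀ := 0) (analyticAt_contactMap (F := h) (G := 0))
    fun x hx v hv => contactMap_injective hh (isHomogeneous_zero _ _ _) (by rwa [h0]) hx v hv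
  refine (hZ.image fun x => ![x 0, x 1, -1]).mono ?_
  rintro l ⟨hb, h2⟩
  have hl : l = ![l 0, l 1, -1] := by ext i; fin_cases i <;> simp [h2]
  rw [hl] at hb
  obtain ⟨x, hx, hx0, hx1⟩ := isBitangent_iff_exists_isContact.mp hb
  refine ⟨x, ?_, ?_⟩
  · refine (contactMap_eq_zero_iff hh (isHomogeneous_zero _ _ _)).mpr ?_
    rwa [h0]
  · simp only [hx0, hx1]
    exact hl.symm

lemma countable_bitangents (hh : h.IsHomogeneous 4) (hs : IsSmoothForm h) (i : Fin 3) :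
    {l | IsBitangent h l ∧ l i = -1}.Countable := by
  have hAA : Matrix.swap ℂ i 2 * Matrix.swap ℂ i 2 = 1 := Matrix.swap_mul_self i 2
  refine ((countable_bitangents_chart (isHomogeneous_linSubst (Matrix.swap ℂ i 2) hh)
    (hs.linSubst hAA)).image (· ᵥ* Matrix.swap ℂ i 2)).mono ?_
  rintro l ⟨hb, hi⟩
  refine ⟨l ᵥ* Matrix.swap ℂ i 2, ⟨hb.linSubst _, ?_⟩, by simp [hAA]⟩
  rw [← hi]
  fin_cases i <;> simp [Matrix.swap, vecMul, dotProduct, Fin.sum_univ_three, PEquiv.toMatrix_apply,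
    Equiv.swap_apply_def]

/-- In suitable coordinates, no bitangent passes through a given coordinate point. -/
lemma exists_generic_coordinates (hh : h.IsHomogeneous 4) (hs : IsSmoothForm h) :
    ∃ A B : Matrix (Fin 3) (Fin 3) ℂ, A * B = 1 ∧
      ∀ l, l ≠ 0 → IsBitangent (_root_.linSubst A h) l → l 2 ≠ 0 := by
  let S : Set (Fin 3 → ℂ) := ⋃ i : Fin 3, {l | IsBitangent h l ∧ l i = -1}
  have hS : S.Countable := Set.countable_iUnion fun i => countable_bitangents hh hs i
  have hbad : (⋃ l ∈ S, {t : ℂ | l 1 * t ^ 2 + l 0 * t + l 2 = 0}).Countable := by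
    refine hS.biUnion fun l hl => Set.Finite.countable ?_
    have hp : Polynomial.C (l 1) * Polynomial.X ^ 2 + Polynomial.C (l 0) * Polynomial.X +
        Polynomial.C (l 2) ≠ 0 := by
      intro e
      obtain ⟨i, -, hi⟩ := Set.mem_iUnion.mp hl
      have e0 := congrArg (Polynomial.coeff · 0) e
      have e1 := congrArg (Polynomial.coeff · 1) e
      have e2 := congrArg (Polynomial.coeff · 2) e
      simp [Polynomial.coeff_X, Polynomial.coeff_C] at e0 e1 e2
      fin_cases i <;> simp_all
    refine (Polynomial.finite_setOfPred_isRoot hp).subset fun t ht => ?_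
    simpa [Polynomial.IsRoot] using ht
  obtain ⟨t, ht⟩ := (hbad.dense_compl ℂ).nonempty
  have hAB : (!![1, 0, t; 0, 1, t ^ 2; 0, 0, 1] : Matrix (Fin 3) (Fin 3) ℂ) *
      !![1, 0, -t; 0, 1, -t ^ 2; 0, 0, 1] = 1 := by
    ext i j
    fin_cases i <;> fin_cases j <;> simp [Matrix.mul_apply, Fin.sum_univ_three]
  refine ⟨_, _, hAB, fun l hl hb h2 => ?_⟩
  set A : Matrix (Fin 3) (Fin 3) ℂ := !![1, 0, t; 0, 1, t ^ 2; 0, 0, 1] with hA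
  set B : Matrix (Fin 3) (Fin 3) ℂ := !![1, 0, -t; 0, 1, -t ^ 2; 0, 0, 1]
  have hBA : B * A = 1 := mul_eq_one_comm.mp hAB
  set m := l ᵥ* B with hm
  have hm0 : m ≠ 0 := vecMul_ne_zero_of_mul_eq_one hl hBA
  have hlm : l = m ᵥ* A := by rw [hm, vecMul_vecMul, hBA, vecMul_one]
  obtain ⟨i, hi⟩ := Function.ne_iff.mp hm0
  have hmi : m i ≠ 0 := hi
  refine ht (Set.mem_iUnion₂.mpr ⟨(-(m i)⁻¹) • m, Set.mem_iUnion.mpr ⟨i, ?_, ?_⟩, ?_⟩)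
  · exact (hb.of_linSubst hAB).smul (by simpa using hmi)
  · simp [hmi]
  · rw [hlm, hA] at h2
    simp [vecMul, dotProduct, Fin.sum_univ_three] at h2
    change -(m i)⁻¹ * m 1 * t ^ 2 + -(m i)⁻¹ * m 0 * t + -(m i)⁻¹ * m 2 = 0
    linear_combination -(m i)⁻¹ * h2

end

section
open Filter Topology

variable {F G : MvPolynomial (Fin 3) ℂ} (hF : F.IsHomogeneous 4) (hG : G.IsHomogeneous 4) {s₀ : ℂ}
  (hs : ∀ᶠ s in 𝓝 s₀, IsSmoothForm (F + C s * G))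
include hF hG hs

lemma eventually_card_of_generic (hz : ∀ l, l ≠ 0 → IsBitangent (F + C s₀ * G) l → l 2 ≠ 0) :
    ∃ n, ∀ᶠ s in 𝓝 s₀, ∃ T, IsBitangentSystem (F + C s * G) T ∧ T.card = n := by
  obtain ⟨K, hK, hKs⟩ := eventually_isContact_mem_compact hz
  obtain ⟨n, hn⟩ := eventually_ncard_zeros (analyticAt_contactMap (F := F) (G := G))
    (fun x hx v hv => contactMap_injective hF hG hs.self_of_nhds hx v hv) hK
    (hKs.mono fun s h x hx => h.2 x ((contactMap_eq_zero_iff hF hG).mp hx))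
  refine ⟨n / 2, ?_⟩
  filter_upwards [hs, hKs, hn] with s h1 h2 h3
  simp only [contactMap_eq_zero_iff hF hG] at h3
  obtain ⟨T, hT, hc⟩ := exists_isBitangentSystem (hF.add (hG.C_mul s)) h1 h3.1 h2.1
  exact ⟨T, hT, by omega⟩

/-- The number of bitangents is locally constant in a pencil of smooth quartics. -/
lemma eventually_card :
    ∃ n, ∀ᶠ s in 𝓝 s₀, ∃ T, IsBitangentSystem (F + C s * G) T ∧ T.card = n := by
  obtain ⟨A, B, hAB, hz⟩ := exists_generic_coordinates (hF.add (hG.C_mul s₀)) hs.self_of_nhds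
  have hlin (s : ℂ) : linSubst A (F + C s * G) = linSubst A F + C s * linSubst A G :=
    MvPolynomial.funext fun x => by simp
  rw [hlin] at hz
  obtain ⟨n, hn⟩ := eventually_card_of_generic (isHomogeneous_linSubst A hF)
    (isHomogeneous_linSubst A hG) (hs.mono fun s h => by rw [← hlin]; exact h.linSubst hAB) hz
  refine ⟨n, hn.mono fun s ⟨T, hT, hc⟩ => ?_⟩
  rw [← hlin] at hT
  obtain ⟨T', hT', hc'⟩ := hT.linSubst (mul_eq_one_comm.mp hAB)
  rw [linSubst_linSubst, hAB, linSubst_one] at hT'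
  exact ⟨T', hT', hc'.trans hc⟩

end

/-- The Fermat quartic. -/
noncomputable def fermatQuartic : MvPolynomial (Fin 3) ℂ := ∑ i, X i ^ 4

lemma isHomogeneous_fermatQuartic : fermatQuartic.IsHomogeneous 4 :=
  IsHomogeneous.sum _ _ _ fun i _ => isHomogeneous_X_pow i 4

lemma eval_pderiv_fermatQuartic (x : Fin 3 → ℂ) (i : Fin 3) :
    eval x (pderiv i fermatQuartic) = 4 * x i ^ 3 := by
  simp [fermatQuartic, Derivation.leibniz_pow, pderiv_X, Pi.single_apply]

lemma isSmoothForm_fermatQuartic : IsSmoothForm fermatQuartic := by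
  intro x hx _
  obtain ⟨i, hi⟩ := Function.ne_iff.mp hx
  exact ⟨i, by rw [eval_pderiv_fermatQuartic]; simpa using hi⟩

/-- Each degree seven monomial in three variables is divisible by the cube of a variable. -/
lemma exists_three_le {m : Fin 3 →₀ ℕ} (hm : ∑ i, m i = 7) : ∃ i, 3 ≤ m i := by
  by_contra! h
  have h0 := h 0
  have h1 := h 1
  have h2 := h 2
  rw [Fin.sum_univ_three] at hm
  omega

lemma finite_not_isSmoothForm {G : MvPolynomial (Fin 3) ℂ} (hG : G.IsHomogeneous 4) :
    {s | ¬ IsSmoothForm (fermatQuartic + C s * G)}.Finite := by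
  classical
  let I := {m : Fin 3 →₀ ℕ // m ∈ Finset.finsuppAntidiag (Finset.univ : Finset (Fin 3)) 7}
  let _ : Fintype I := Finset.Subtype.fintype _
  have hI (m : I) : ∑ i, m.1 i = 7 := (Finset.mem_finsuppAntidiag.mp m.2).1
  choose j hj using fun m : I => exists_three_le (hI m)
  have hr (m : I) : ∃ r : Fin 3 →₀ ℕ, r + Finsupp.single (j m) 3 = m.1 :=
    ⟨_, tsub_add_cancel_of_le (Finsupp.single_le_iff.mpr (hj m))⟩
  choose r hr using hr
  let P (m : I) : MvPolynomial (Fin 3) ℂ := pderiv (j m) G * monomial (r m) 1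
  have hP (m : I) : (P m).IsHomogeneous 7 := by
    refine (hG.pderiv (i := j m)).mul (n := 4) (isHomogeneous_monomial _ ?_)
    have h2 := congrArg Finsupp.degree (hr m)
    rw [map_add, Finsupp.degree_single, Finsupp.degree_eq_sum m.1, hI m] at h2
    omega
  let N : Matrix I I ℂ := Matrix.of fun m m' => coeff m'.1 (P m)
  have hN (x : Fin 3 → ℂ) (m : I) :
      (N *ᵥ fun m' => ∏ i, x i ^ m'.1 i) m = eval x (P m) := by
    rw [eval_eq']
    simp only [mulVec, dotProduct, N, Matrix.of_apply]
    rw [Finset.sum_coe_sort (Finset.finsuppAntidiag (Finset.univ : Finset (Fin 3)) 7)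
      (fun m' => coeff m' (P m) * ∏ i, x i ^ m' i)]
    symm
    refine Finset.sum_subset (fun d hd => ?_) fun d _ hd => ?_
    · rw [Finset.mem_finsuppAntidiag]
      refine ⟨?_, Finset.subset_univ _⟩
      have := hP m (mem_support_iff.mp hd)
      simpa [Finsupp.weight_apply, Finsupp.sum_fintype] using this
    · rw [notMem_support_iff.mp hd, zero_mul]
  have hfin := Module.End.finite_hasEigenvalue (Matrix.toLin' N)
  refine (hfin.image fun μ => -4 * μ⁻¹).subset fun s hs => ?_
  obtain ⟨x, hx, -, hsing⟩ : ∃ x, x ≠ 0 ∧ eval x (fermatQuartic + C s * G) = 0 ∧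
      ∀ i, eval x (pderiv i (fermatQuartic + C s * G)) = 0 := by
    have hs' : ¬ IsSmoothForm (fermatQuartic + C s * G) := hs
    unfold IsSmoothForm at hs'
    push Not at hs'
    exact hs'
  have hsing' (i : Fin 3) : 4 * x i ^ 3 + s * eval x (pderiv i G) = 0 := by
    simpa [eval_pderiv_fermatQuartic] using hsing i
  obtain ⟨i, hi⟩ := Function.ne_iff.mp hx
  have hi : x i ≠ 0 := hi
  have hs0 : s ≠ 0 := by
    rintro rfl
    have := hsing' i
    simp [hi] at this
  refine ⟨-4 * s⁻¹, ?_, by field_simp⟩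
  refine Module.End.hasEigenvalue_of_hasEigenvector (x := fun m' : I => ∏ i, x i ^ m'.1 i)
    (Module.End.hasEigenvector_iff.mpr ⟨?_, ?_⟩)
  · rw [Module.End.mem_eigenspace_iff, Matrix.toLin'_apply]
    ext m
    rw [hN]
    have h2 : ∏ i, x i ^ m.1 i = (∏ i, x i ^ r m i) * x (j m) ^ 3 := by
      rw [← hr m]
      simp only [Finsupp.add_apply, pow_add, Finset.prod_mul_distrib]
      congr 1
      rw [Finset.prod_eq_single (j m) (fun b _ hb => by simp [hb.symm])
        (by simp)]
      simp
    have h3 : eval x (P m) = eval x (pderiv (j m) G) * ∏ i, x i ^ r m i := by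
      simp [P, eval_monomial, Finsupp.prod_fintype]
    rw [h3, Pi.smul_apply, smul_eq_mul, h2]
    field_simp
    linear_combination (∏ i, x i ^ r m i) * hsing' (j m)
  · intro h0
    have h1 := congrFun h0 ⟨Finsupp.single i 7, by
      rw [Finset.mem_finsuppAntidiag]
      exact ⟨by simp [Finsupp.single_apply], Finset.subset_univ _⟩⟩
    simp [Finsupp.single_apply, hi] at h1

section
open Topology

/-- The number of representations does not change along a pencil of smooth quartics. -/
lemma ncard_conicSpans_eq_fermatQuartic {f : MvPolynomial (Fin 3) ℂ} (hf : f.IsHomogeneous 4)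
    (hs : IsSmoothForm f) : (conicSpans f).ncard = (conicSpans fermatQuartic).ncard := by
  have hF := isHomogeneous_fermatQuartic
  have hG := hf.sub hF
  have hfin := finite_not_isSmoothForm hG
  have hrank : 1 < Module.rank ℝ ℂ := by simp
  have hconn := (hfin.countable.isConnected_compl_of_one_lt_rank hrank).isPreconnected
  have h1 : fermatQuartic + C 1 * (f - fermatQuartic) = f := by simp
  have h0 : fermatQuartic + C 0 * (f - fermatQuartic) = fermatQuartic := by simp
  have hcont : ContinuousOn
      (fun s => (conicSpans (fermatQuartic + C s * (f - fermatQuartic))).ncard)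
      {s | ¬ IsSmoothForm (fermatQuartic + C s * (f - fermatQuartic))}ᶜ := by
    intro s hs
    refine ContinuousAt.continuousWithinAt ?_
    have hev : ∀ᶠ t in 𝓝 s, IsSmoothForm (fermatQuartic + C t * (f - fermatQuartic)) := by
      filter_upwards [hfin.isClosed.isOpen_compl.mem_nhds hs] with t ht
      exact not_not.mp ht
    obtain ⟨n, hn⟩ := eventually_card hF hG hev
    have hQ : ∀ᶠ t in 𝓝 s,
        6 * (conicSpans (fermatQuartic + C t * (f - fermatQuartic))).ncard = n.choose 2 := by
      filter_upwards [hn, hev] with t ⟨T, hT, hc⟩ ht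
      rw [← hc]
      exact hT.ncard_conicSpans (hF.add (hG.C_mul t)) ht
    refine continuousAt_const.congr (f := fun _ =>
      (conicSpans (fermatQuartic + C s * (f - fermatQuartic))).ncard) ?_
    filter_upwards [hQ] with t ht
    have := hQ.self_of_nhds
    omega
  have := hconn.constant hcont (x := 1) (y := 0)
    (fun h => h (by rwa [h1])) (fun h => h (by rw [h0]; exact isSmoothForm_fermatQuartic))
  simpa only [h1, h0] using this

end

lemma exists_finset_pow_four {c : ℂ} (hc : c ≠ 0) :
    ∃ S : Finset ℂ, S.card = 4 ∧ ∀ u, u ∈ S ↔ u ^ 4 = c := by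
  classical
  obtain ⟨ζ, hζ⟩ := IsAlgClosed.exists_pow_nat_eq c (n := 4) (by norm_num)
  have hζ0 : ζ ≠ 0 := by
    rintro rfl
    exact hc (by simpa using hζ.symm)
  refine ⟨({1, -1, Complex.I, -Complex.I} : Finset ℂ).image (ζ * ·), ?_, fun u => ?_⟩
  · rw [Finset.card_image_of_injective _ (mul_right_injective₀ hζ0)]
    have h1 : (1 : ℂ) ≠ -1 := by norm_num
    have h2 : (1 : ℂ) ≠ Complex.I := fun h => by simpa using congrArg Complex.re h
    have h3 : (1 : ℂ) ≠ -Complex.I := fun h => by simpa using congrArg Complex.re h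
    have h4 : (-1 : ℂ) ≠ Complex.I := fun h => by simpa using congrArg Complex.re h
    have h5 : (-1 : ℂ) ≠ -Complex.I := fun h => by simpa using congrArg Complex.re h
    have h6 : Complex.I ≠ -Complex.I := fun h => by
      have := congrArg Complex.im h
      norm_num at this
    simp [Finset.card_insert_of_notMem, h1, h2, h3, h4, h5, h6]
  · simp only [Finset.mem_image, Finset.mem_insert, Finset.mem_singleton]
    constructor
    · rintro ⟨w, rfl | rfl | rfl | rfl, rfl⟩
      · linear_combination hζ
      · linear_combination hζ
      · linear_combination hζ + ζ ^ 4 * (Complex.I ^ 2 - 1) * Complex.I_sq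
      · linear_combination hζ + ζ ^ 4 * (Complex.I ^ 2 - 1) * Complex.I_sq
    · intro hu
      have h1 : (u / ζ) ^ 4 = 1 := by rw [div_pow, hu, hζ, div_self hc]
      refine ⟨u / ζ, ?_, by field_simp⟩
      have h2 : (u / ζ - 1) * ((u / ζ + 1) * ((u / ζ - Complex.I) * (u / ζ + Complex.I))) = 0 := by
        linear_combination h1 + (1 - (u / ζ) ^ 2) * Complex.I_sq
      rcases mul_eq_zero.mp h2 with h | h
      · exact Or.inl (sub_eq_zero.mp h)
      rcases mul_eq_zero.mp h with h | h
      · exact Or.inr (Or.inl (eq_neg_of_add_eq_zero_left h))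
      rcases mul_eq_zero.mp h with h | h
      · exact Or.inr (Or.inr (Or.inl (sub_eq_zero.mp h)))
      · exact Or.inr (Or.inr (Or.inr (eq_neg_of_add_eq_zero_left h)))

lemma eval_fermatQuartic (x : Fin 3 → ℂ) :
    eval x fermatQuartic = x 0 ^ 4 + x 1 ^ 4 + x 2 ^ 4 := by
  simp [fermatQuartic, Fin.sum_univ_three]

/-- The solutions of the contact equations in the case of the Fermat quartic. -/
lemma contact_equations {u v a b c : ℂ} (hA : 1 + u ^ 4 = a ^ 2) (hB : 2 * u ^ 3 * v = a * b)
    (hC : 6 * u ^ 2 * v ^ 2 = b ^ 2 + 2 * a * c) (hD : 2 * u * v ^ 3 = b * c)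
    (hE : 1 + v ^ 4 = c ^ 2) :
    (u ^ 4 = 1 ∧ v ^ 4 = 1) ∨ (u ^ 4 = -1 ∧ v = 0) ∨ (u = 0 ∧ v ^ 4 = -1) := by
  by_cases hu : u = 0
  · subst hu
    have ha : a ≠ 0 := by
      rintro rfl
      norm_num at hA
    have hb : b = 0 := by simpa [ha] using hB.symm
    have hc : c = 0 := by simpa [ha, hb] using hC.symm
    exact Or.inr (Or.inr ⟨rfl, by rw [hc] at hE; linear_combination hE⟩)
  by_cases hv : v = 0
  · subst hv
    have hc : c ≠ 0 := by
      rintro rfl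
      norm_num at hE
    have hb : b = 0 := by simpa [hc] using hD.symm
    have ha : a = 0 := by simpa [hc, hb] using hC.symm
    exact Or.inr (Or.inl ⟨by rw [ha] at hA; linear_combination hA, rfl⟩)
  have huv : u ^ 2 * v ^ 2 ≠ 0 := by positivity
  have key : (b ^ 2 - 2 * u ^ 2 * v ^ 2) * (b ^ 2 - 4 * u ^ 2 * v ^ 2) = 0 := by
    linear_combination -b ^ 2 * hC + 4 * u * v ^ 3 * hB + 2 * a * b * hD
  have hab : a ^ 2 * b ^ 2 = 4 * u ^ 6 * v ^ 2 := by
    linear_combination -(2 * u ^ 3 * v + a * b) * hB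
  have hbc : b ^ 2 * c ^ 2 = 4 * u ^ 2 * v ^ 6 := by
    linear_combination -(2 * u * v ^ 3 + b * c) * hD
  rcases mul_eq_zero.mp key with h | h
  · left
    constructor
    · have : u ^ 2 * v ^ 2 * (1 - u ^ 4) = 0 := by
        linear_combination (1 / 2 : ℂ) * hab + u ^ 2 * v ^ 2 * hA - (1 / 2 : ℂ) * a ^ 2 * h
      linear_combination -(mul_eq_zero.mp this).resolve_left huv
    · have : u ^ 2 * v ^ 2 * (1 - v ^ 4) = 0 := by
        linear_combination (1 / 2 : ℂ) * hbc + u ^ 2 * v ^ 2 * hE - (1 / 2 : ℂ) * c ^ 2 * h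
      linear_combination -(mul_eq_zero.mp this).resolve_left huv
  · exfalso
    apply huv
    linear_combination (1 / 4 : ℂ) * hab + u ^ 2 * v ^ 2 * hA - (1 / 4 : ℂ) * a ^ 2 * h

lemma isBitangent_fermatQuartic_iff {u v : ℂ} : IsBitangent fermatQuartic ![u, v, -1] ↔
    (u ^ 4 = 1 ∧ v ^ 4 = 1) ∨ (u ^ 4 = -1 ∧ v = 0) ∨ (u = 0 ∧ v ^ 4 = -1) := by
  rw [isBitangent_iff_exists_isContact]
  constructor
  · rintro ⟨x, hx, rfl, rfl⟩
    simp only [IsContact, eval_fermatQuartic, Matrix.cons_val] at hx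
    have h10 := hx 1 0
    have h01 := hx 0 1
    have h11 := hx 1 1
    have h1m := hx 1 (-1)
    have h12 := hx 1 2
    refine contact_equations (a := x 2) (b := x 3) (c := x 4) ?_ ?_ ?_ ?_ ?_
    · linear_combination h10
    · linear_combination -(1 / 4 : ℂ) * h10 + h01 + (1 / 2 : ℂ) * h11 - (1 / 6 : ℂ) * h1m
        - (1 / 12 : ℂ) * h12
    · linear_combination (1 / 2 : ℂ) * (h11 + h1m) - h10 - h01
    · linear_combination (1 / 4 : ℂ) * h10 - h01 - (1 / 4 : ℂ) * h11 - (1 / 12 : ℂ) * h1m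
        + (1 / 12 : ℂ) * h12
    · linear_combination h01
  · obtain ⟨r, hr⟩ := IsAlgClosed.exists_pow_nat_eq (2 : ℂ) (n := 2) (by norm_num)
    rintro (⟨hu, hv⟩ | ⟨hu, rfl⟩ | ⟨rfl, hv⟩)
    · refine ⟨![u, v, r, r * (u ^ 3 * v), r * (u ^ 2 * v ^ 2)], fun X Y => ?_, rfl, rfl⟩
      simp only [eval_fermatQuartic, Matrix.cons_val]
      have h : (r * X ^ 2 + r * (u ^ 3 * v) * X * Y + r * (u ^ 2 * v ^ 2) * Y ^ 2) ^ 2 =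
        2 * (X ^ 2 + u ^ 3 * v * X * Y + u ^ 2 * v ^ 2 * Y ^ 2) ^ 2 := by rw [← hr]; ring
      rw [h]
      linear_combination (X ^ 4 - 2 * u ^ 2 * v ^ 2 * X ^ 2 * Y ^ 2 - 4 * u * v ^ 3 * X * Y ^ 3
        - 2 * v ^ 4 * Y ^ 4) * hu - Y ^ 4 * hv
    · refine ⟨![u, 0, 0, 0, 1], fun X Y => ?_, rfl, rfl⟩
      simp only [eval_fermatQuartic, Matrix.cons_val]
      linear_combination X ^ 4 * hu
    · refine ⟨![0, v, 1, 0, 0], fun X Y => ?_, rfl, rfl⟩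
      simp only [eval_fermatQuartic, Matrix.cons_val]
      linear_combination Y ^ 4 * hv

lemma linSubst_swap_fermatQuartic (i j : Fin 3) :
    linSubst (Matrix.swap ℂ i j) fermatQuartic = fermatQuartic := by
  refine MvPolynomial.funext fun x => ?_
  rw [eval_linSubst, Matrix.swap_mulVec]
  simp only [fermatQuartic, map_sum, map_pow, eval_X, Function.comp_apply]
  exact Equiv.sum_comp (Equiv.swap i j) fun i => x i ^ 4

lemma isBitangent_fermatQuartic_swap {l : Fin 3 → ℂ} (i j : Fin 3)
    (hl : IsBitangent fermatQuartic l) : IsBitangent fermatQuartic (l ∘ Equiv.swap i j) := by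
  have := hl.linSubst (Matrix.swap ℂ i j)
  rwa [linSubst_swap_fermatQuartic, Matrix.vecMul_swap] at this

/-- The bitangents of the Fermat quartic through the point `(0, 0, 1)`. -/
lemma isBitangent_fermatQuartic_iff' {t : ℂ} :
    IsBitangent fermatQuartic ![t, -1, 0] ↔ t ^ 4 = -1 := by
  have e : ![t, -1, 0] ∘ Equiv.swap (1 : Fin 3) 2 = ![t, 0, -1] := by
    ext i; fin_cases i <;> simp [Equiv.swap_apply_def]
  have e' : ![t, 0, -1] ∘ Equiv.swap (1 : Fin 3) 2 = ![t, -1, 0] := by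
    ext i; fin_cases i <;> simp [Equiv.swap_apply_def]
  constructor
  · intro h
    have := isBitangent_fermatQuartic_swap 1 2 h
    rw [e, isBitangent_fermatQuartic_iff] at this
    simpa using this
  · intro h
    rw [← e']
    exact isBitangent_fermatQuartic_swap 1 2 (isBitangent_fermatQuartic_iff.mpr (by simp [h]))

lemma not_isBitangent_fermatQuartic : ¬ IsBitangent fermatQuartic ![-1, 0, 0] := by
  intro h
  have e : ![-1, 0, 0] ∘ Equiv.swap (0 : Fin 3) 2 = ![(0 : ℂ), 0, -1] := by
    ext i; fin_cases i <;> simp [Equiv.swap_apply_def]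
  have := isBitangent_fermatQuartic_swap 0 2 h
  rw [e, isBitangent_fermatQuartic_iff] at this
  simp at this

lemma exists_isBitangentSystem_fermatQuartic :
    ∃ T, IsBitangentSystem fermatQuartic T ∧ T.card = 28 := by
  classical
  obtain ⟨S, hS, hmS⟩ := exists_finset_pow_four (one_ne_zero (α := ℂ))
  obtain ⟨R, hR, hmR⟩ := exists_finset_pow_four (neg_ne_zero.mpr (one_ne_zero (α := ℂ)))
  have hS0 : (0 : ℂ) ∉ S := by simp [hmS]
  have hR0 : (0 : ℂ) ∉ R := by simp [hmR]
  let T₁ := (S ×ˢ S).image fun p => ![p.1, p.2, -1]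
  let T₂ := R.image fun u => ![u, 0, -1]
  let T₃ := R.image fun v => ![0, v, -1]
  let T₄ := R.image fun t => ![t, -1, 0]
  have hmem (l : Fin 3 → ℂ) : l ∈ T₁ ∪ (T₂ ∪ (T₃ ∪ T₄)) ↔ IsBitangent fermatQuartic l ∧
      ((∃ u v, l = ![u, v, -1]) ∨ ∃ t, l = ![t, -1, 0]) := by
    simp only [T₁, T₂, T₃, T₄, Finset.mem_union, Finset.mem_image, Finset.mem_product, Prod.exists,
      hmS, hmR]
    constructor
    · rintro (⟨u, v, h, rfl⟩ | ⟨u, h, rfl⟩ | ⟨v, h, rfl⟩ | ⟨t, h, rfl⟩)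
      · exact ⟨isBitangent_fermatQuartic_iff.mpr (Or.inl h), Or.inl ⟨_, _, rfl⟩⟩
      · exact ⟨isBitangent_fermatQuartic_iff.mpr (Or.inr (Or.inl ⟨h, rfl⟩)), Or.inl ⟨_, _, rfl⟩⟩
      · exact ⟨isBitangent_fermatQuartic_iff.mpr (Or.inr (Or.inr ⟨rfl, h⟩)), Or.inl ⟨_, _, rfl⟩⟩
      · exact ⟨isBitangent_fermatQuartic_iff'.mpr h, Or.inr ⟨_, rfl⟩⟩
    · rintro ⟨h, ⟨u, v, rfl⟩ | ⟨t, rfl⟩⟩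
      · rcases isBitangent_fermatQuartic_iff.mp h with h₁ | ⟨h₁, rfl⟩ | ⟨rfl, h₁⟩
        · exact Or.inl ⟨u, v, h₁, rfl⟩
        · exact Or.inr (Or.inl ⟨u, h₁, rfl⟩)
        · exact Or.inr (Or.inr (Or.inl ⟨v, h₁, rfl⟩))
      · exact Or.inr (Or.inr (Or.inr ⟨t, isBitangent_fermatQuartic_iff'.mp h, rfl⟩))
  have hnorm {l : Fin 3 → ℂ} (hl : l ∈ T₁ ∪ (T₂ ∪ (T₃ ∪ T₄))) :
      l 2 = -1 ∨ (l 2 = 0 ∧ l 1 = -1) := by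
    rcases ((hmem l).mp hl).2 with ⟨u, v, rfl⟩ | ⟨t, rfl⟩
    · simp
    · simp
  have hne {l : Fin 3 → ℂ} (hl : l ∈ T₁ ∪ (T₂ ∪ (T₃ ∪ T₄))) : l ≠ 0 := by
    rintro rfl
    have := hnorm hl
    simp at this
  refine ⟨T₁ ∪ (T₂ ∪ (T₃ ∪ T₄)), ⟨fun l hl => hne hl, fun l hl => ((hmem l).mp hl).1, ?_, ?_⟩, ?_⟩
  · intro l hl m hm hlm hc
    obtain ⟨k, rfl⟩ := (cross_eq_zero_iff (hne hl)).mp hc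
    have h1 := hnorm hl
    have h2 := hnorm hm
    simp only [Pi.smul_apply, smul_eq_mul] at h2
    have hk : k = 1 := by
      rcases h1 with h1 | ⟨h1, h1'⟩
      · rw [h1] at h2
        rcases h2 with h2 | ⟨h2, h2'⟩
        · linear_combination -h2
        · have : k = 0 := by linear_combination -h2
          simp [this] at h2'
      · rw [h1, h1'] at h2
        simpa using h2
    exact hlm (by rw [hk, one_smul])
  · intro l hl hb
    obtain ⟨k, hk, hkl⟩ : ∃ k : ℂ, k ≠ 0 ∧ ((∃ u v, k • l = ![u, v, -1]) ∨
        (∃ t, k • l = ![t, -1, 0]) ∨ k • l = ![-1, 0, 0]) := by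
      by_cases h2 : l 2 = 0
      · by_cases h1 : l 1 = 0
        · have h0 : l 0 ≠ 0 := fun h0 => hl (by ext i; fin_cases i <;> simp [h0, h1, h2])
          refine ⟨-(l 0)⁻¹, by simpa using h0, Or.inr (Or.inr ?_)⟩
          ext i; fin_cases i <;> simp [h0, h1, h2]
        · refine ⟨-(l 1)⁻¹, by simpa using h1, Or.inr (Or.inl ⟨-(l 1)⁻¹ * l 0, ?_⟩)⟩
          ext i; fin_cases i <;> simp [h1, h2]
      · refine ⟨-(l 2)⁻¹, by simpa using h2, Or.inl ⟨-(l 2)⁻¹ * l 0, -(l 2)⁻¹ * l 1, ?_⟩⟩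
        ext i; fin_cases i <;> simp [h2]
    have hb' := hb.smul hk
    refine ⟨k • l, (hmem _).mpr ⟨hb', ?_⟩, (cross_eq_zero_iff hl).mpr ⟨k, rfl⟩⟩
    rcases hkl with h | h | h
    · exact Or.inl h
    · exact Or.inr h
    · rw [h] at hb'
      exact absurd hb' not_isBitangent_fermatQuartic
  · have h1 : T₁.card = 16 := by
      rw [Finset.card_image_of_injective, Finset.card_product, hS]
      rintro ⟨a, b⟩ ⟨c, d⟩ h
      exact Prod.ext (congrFun h 0) (congrFun h 1)
    have h2 : T₂.card = 4 := by
      rw [Finset.card_image_of_injective, hR]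
      exact fun a b h => congrFun h 0
    have h3 : T₃.card = 4 := by
      rw [Finset.card_image_of_injective, hR]
      exact fun a b h => congrFun h 1
    have h4 : T₄.card = 4 := by
      rw [Finset.card_image_of_injective, hR]
      exact fun a b h => congrFun h 0
    rw [Finset.card_union_of_disjoint, Finset.card_union_of_disjoint,
      Finset.card_union_of_disjoint, h1, h2, h3, h4]
    · simp only [T₃, T₄, Finset.disjoint_left, Finset.mem_image]
      rintro _ ⟨v, hv, rfl⟩ ⟨t, ht, h⟩
      simpa using congrFun h 2
    · simp only [T₂, T₃, T₄, Finset.disjoint_left, Finset.mem_image, Finset.mem_union]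
      rintro _ ⟨u, hu, rfl⟩ (⟨v, hv, h⟩ | ⟨t, ht, h⟩)
      · have : v = 0 := congrFun h 1
        exact hR0 (this ▸ hv)
      · simpa using congrFun h 2
    · simp only [T₁, T₂, T₃, T₄, Finset.disjoint_left, Finset.mem_image, Finset.mem_union,
        Finset.mem_product]
      rintro _ ⟨⟨u, v⟩, ⟨hu, hv⟩, rfl⟩ (⟨w, hw, h⟩ | ⟨w, hw, h⟩ | ⟨t, ht, h⟩)
      · have : 0 = v := congrFun h 1
        exact hS0 (this ▸ hv)
      · have : 0 = u := congrFun h 0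
        exact hS0 (this ▸ hu)
      · simpa using congrFun h 2

lemma ncard_conicSpans_fermatQuartic : (conicSpans fermatQuartic).ncard = 63 := by
  obtain ⟨T, hT, hc⟩ := exists_isBitangentSystem_fermatQuartic
  have h1 := hT.ncard_conicSpans isHomogeneous_fermatQuartic isSmoothForm_fermatQuartic
  rw [hc, show Nat.choose 28 2 = 378 from rfl] at h1
  omega

end

/-- A complex ternary quartic form defining a smooth complex plane curve has
exactly 63 inequivalent quadratic representations. -/
theorem sixtythree_quadratic_representations
    (f : MvPolynomial (Fin 3) ℂ)
    (hf : f.IsHomogeneous 4)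
    (hsmooth : ∀ x : Fin 3 → ℂ, x ≠ 0 →
      MvPolynomial.eval x f = 0 →
      ∃ i : Fin 3, MvPolynomial.eval x (MvPolynomial.pderiv i f) ≠ 0) :
    Nat.card (Quotient (QuadRepSetoid f)) = 63 := by
  rw [card_quotient_quadRep, ncard_conicSpans_eq_fermatQuartic hf hsmooth,
    ncard_conicSpans_fermatQuartic]
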